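/- Combined first-order coercivity of 𝓛_Γ^T: if α < 10^{-14}, η = 99/100, γ = 1 + α/10, then for every admissible f, 10·(𝓛_Γ^T(f)·w, f·w/sin(2θ)^η)_{L²} + 10⁸·(𝓛_Γ^T(f)·w, f·w)_{L²} + 10^{12}·(D_θ(𝓛_Γ^T(f)), (D_θ f)·w²/sin(2θ)^γ)_{L²} ≥ ‖f·w/sin(2θ)^{η/2}‖²_{L²} + ‖(D_θ f)·w/sin(2θ)^{γ/2}‖²_{L²} + ‖f·w‖²_{L²}. -/

import Mathlib

open Real MeasureTheory Set Filter

noncomputable section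

/-- The angular kernel `K(θ) = 3 sin θ cos² θ`. -/
def Kker (θ : ℝ) : ℝ := 3 * Real.sin θ * Real.cos θ ^ 2

/-- `L₁₂(f)(z) = ∫_z^∞ ∫_0^{π/2} f(r,θ) K(θ)/r dθ dr`. -/
def L12 (f : ℝ → ℝ → ℝ) (z : ℝ) : ℝ :=
  ∫ r in Ioi z, ∫ θ in Icc 0 (π / 2), f r θ * Kker θ / r

/-- The radial weight `w(z) = (1+z)²/z²`. -/
def wgt (z : ℝ) : ℝ := (1 + z) ^ 2 / z ^ 2

/-- `D_θ f = sin(2θ) ∂_θ f`. -/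
def Dth (f : ℝ → ℝ → ℝ) (z θ : ℝ) : ℝ := Real.sin (2 * θ) * deriv (fun t => f z t) θ

/-- `D_z f = z ∂_z f`. -/
def Dzr (f : ℝ → ℝ → ℝ) (z θ : ℝ) : ℝ := z * deriv (fun s => f s θ) z

/-- `Γ(θ) = (sin θ cos² θ)^{α/3}`. -/
def Gam (α θ : ℝ) : ℝ := (Real.sin θ * Real.cos θ ^ 2) ^ (α / 3)

/-- `c = ∫_0^{π/2} Γ(θ) K(θ) dθ`. -/
def cGam (α : ℝ) : ℝ := ∫ θ in Icc 0 (π / 2), Gam α θ * Kker θ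

/-- `𝓛(f) = f + z ∂_z f - 2 f/(1+z)`. -/
def Lop (f : ℝ → ℝ → ℝ) (z θ : ℝ) : ℝ :=
  f z θ + z * deriv (fun s => f s θ) z - 2 * f z θ / (1 + z)

/-- `𝓛_Γ(f) = 𝓛(f) - (2zΓ(θ)/(c(1+z)²)) L₁₂(f)`. -/
def LGam (α : ℝ) (f : ℝ → ℝ → ℝ) (z θ : ℝ) : ℝ :=
  Lop f z θ - 2 * z * Gam α θ / (cGam α * (1 + z) ^ 2) * L12 f z

/-- `ℙ(f)(z,θ) = f(z,θ) - (Γ(θ)/c)(2z²/(1+z)³) L₁₂(f)(0)`. -/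
def Pproj (α : ℝ) (f : ℝ → ℝ → ℝ) (z θ : ℝ) : ℝ :=
  f z θ - Gam α θ / cGam α * (2 * z ^ 2 / (1 + z) ^ 3) * L12 f 0

/-- `𝓛_Γ^T(f) = 𝓛_Γ(f) - ℙ((3/(1+z)) D_θ f)`. -/
def LGamT (α : ℝ) (f : ℝ → ℝ → ℝ) (z θ : ℝ) : ℝ :=
  LGam α f z θ - Pproj α (fun z2 θ2 => 3 / (1 + z2) * Dth f z2 θ2) z θ

/-- The `L²` inner product on `[0,∞) × [0,π/2]` with respect to `dz dθ`. -/
def ip (A B : ℝ → ℝ → ℝ) : ℝ :=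
  ∫ z in Ioi (0 : ℝ), ∫ θ in Icc 0 (π / 2), A z θ * B z θ

/-- `f` is admissible: smooth on `[0,∞) × [0,π/2]` and vanishing for `z` outside a
compact subset of `(0,∞)`. -/
def Admissible (f : ℝ → ℝ → ℝ) : Prop :=
  ContDiff ℝ (⊤ : ℕ∞) (Function.uncurry f) ∧
  ∃ a b : ℝ, 0 < a ∧ ∀ z θ : ℝ, z ∉ Icc a b → f z θ = 0

theorem sq_integral_mul_le {X : Type*} [MeasurableSpace X] {μ : Measure X} {F G : X → ℝ}
    (hF : Integrable (fun x => F x ^ 2) μ) (hG : Integrable (fun x => G x ^ 2) μ)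
    (hFG : Integrable (fun x => F x * G x) μ) :
    (∫ x, F x * G x ∂μ) ^ 2 ≤ (∫ x, F x ^ 2 ∂μ) * ∫ x, G x ^ 2 ∂μ := by
  have key : ∀ t : ℝ, 0 ≤ (∫ x, F x ^ 2 ∂μ) * (t * t) + (2 * ∫ x, F x * G x ∂μ) * t
      + ∫ x, G x ^ 2 ∂μ := by
    intro t
    have h : 0 ≤ ∫ x, (F x * t + G x) ^ 2 ∂μ := integral_nonneg fun x => sq_nonneg _
    have e : (fun x => (F x * t + G x) ^ 2)
        = fun x => (F x ^ 2 * (t * t) + (2 * t) * (F x * G x)) + G x ^ 2 := by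
      ext x; ring
    have hadd : Integrable (fun x => F x ^ 2 * (t * t) + (2 * t) * (F x * G x)) μ :=
      (hF.mul_const _).add (hFG.const_mul _)
    rw [e, integral_add hadd hG, integral_add (hF.mul_const _) (hFG.const_mul _), integral_mul_const,
      integral_const_mul] at h
    linarith
  have := discrim_le_zero key
  unfold discrim at this
  nlinarith

theorem le_sin_two_mul {θ : ℝ} (h0 : 0 ≤ θ) (h1 : θ ≤ π / 4) : θ ≤ Real.sin (2 * θ) := by
  have h := Real.mul_le_sin (x := 2 * θ) (by linarith) (by linarith)
  have : θ ≤ 2 / π * (2 * θ) := by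
    rw [div_mul_eq_mul_div, le_div_iff₀ Real.pi_pos]
    nlinarith [Real.pi_le_four]
  linarith

theorem sin_two_mul_pos {θ : ℝ} (h : θ ∈ Ioo 0 (π / 2)) : 0 < Real.sin (2 * θ) :=
  Real.sin_pos_of_pos_of_lt_pi (by linarith [h.1]) (by linarith [h.2])

theorem sin_two_mul_nonneg {θ : ℝ} (h : θ ∈ Icc 0 (π / 2)) : 0 ≤ Real.sin (2 * θ) :=
  Real.sin_nonneg_of_nonneg_of_le_pi (by linarith [h.1]) (by linarith [h.2])

theorem min_le_sin_two_mul {θ : ℝ} (h : θ ∈ Icc 0 (π / 2)) :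
    θ ≤ Real.sin (2 * θ) ∨ π / 2 - θ ≤ Real.sin (2 * θ) := by
  rcases le_total θ (π / 4) with h1 | h1
  · exact Or.inl (le_sin_two_mul h.1 h1)
  · right
    have := le_sin_two_mul (θ := π / 2 - θ) (by linarith [h.2]) (by linarith)
    rwa [show 2 * (π / 2 - θ) = π - 2 * θ by ring, Real.sin_pi_sub] at this

theorem sin_two_mul_rpow_integral {ε : ℝ} (h0 : 0 < ε) (h1 : ε ≤ 1) :
    IntegrableOn (fun θ => Real.sin (2 * θ) ^ (ε - 1)) (Icc 0 (π / 2)) ∧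
      ∫ θ in Icc 0 (π / 2), Real.sin (2 * θ) ^ (ε - 1) ≤ 4 / ε := by
  have hpi := Real.pi_pos
  have i1 : IntervalIntegrable (fun θ : ℝ => θ ^ (ε - 1)) volume 0 (π / 2) :=
    intervalIntegral.intervalIntegrable_rpow' (by linarith)
  have i2 : IntervalIntegrable (fun θ : ℝ => (π / 2 - θ) ^ (ε - 1)) volume 0 (π / 2) := by
    have := (i1.comp_sub_left (π / 2)).symm
    simpa using this
  have e1 : ∫ θ in (0 : ℝ)..(π / 2), θ ^ (ε - 1) = (π / 2) ^ ε / ε := by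
    rw [integral_rpow (Or.inl (by linarith))]
    simp [Real.zero_rpow h0.ne']
  have e2 : ∫ θ in (0 : ℝ)..(π / 2), (π / 2 - θ) ^ (ε - 1) = (π / 2) ^ ε / ε := by
    rw [intervalIntegral.integral_comp_sub_left (fun θ => θ ^ (ε - 1)) (π / 2)]
    simpa using e1
  have hle : ∀ θ ∈ Ioo 0 (π / 2), Real.sin (2 * θ) ^ (ε - 1)
      ≤ θ ^ (ε - 1) + (π / 2 - θ) ^ (ε - 1) := by
    intro θ hθ
    have p1 : 0 ≤ θ ^ (ε - 1) := Real.rpow_nonneg hθ.1.le _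
    have p2 : 0 ≤ (π / 2 - θ) ^ (ε - 1) := Real.rpow_nonneg (by linarith [hθ.2]) _
    rcases min_le_sin_two_mul (Ioo_subset_Icc_self hθ) with h | h
    · linarith [Real.rpow_le_rpow_of_nonpos hθ.1 h (by linarith : ε - 1 ≤ 0)]
    · linarith [Real.rpow_le_rpow_of_nonpos (by linarith [hθ.2] : 0 < π / 2 - θ) h
        (by linarith : ε - 1 ≤ 0)]
  have i3 := i1.add i2
  rw [intervalIntegrable_iff_integrableOn_Ioo_of_le (by positivity)] at i3
  have i4 : IntegrableOn (fun θ => Real.sin (2 * θ) ^ (ε - 1)) (Ioo 0 (π / 2)) := by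
    refine Integrable.mono' i3 ?_ ?_
    · exact (Measurable.pow_const (by fun_prop) _).aestronglyMeasurable
    · filter_upwards [ae_restrict_mem measurableSet_Ioo] with θ hθ
      rw [Real.norm_of_nonneg (Real.rpow_nonneg (sin_two_mul_pos hθ).le _)]
      exact hle θ hθ
  refine ⟨by rwa [integrableOn_Icc_iff_integrableOn_Ioo], ?_⟩
  rw [integral_Icc_eq_integral_Ioo]
  calc _ ≤ ∫ θ in Ioo 0 (π / 2), (θ ^ (ε - 1) + (π / 2 - θ) ^ (ε - 1)) :=
        setIntegral_mono_on i4 i3 measurableSet_Ioo hle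
    _ = 2 * ((π / 2) ^ ε / ε) := by
        rw [← integral_Ioc_eq_integral_Ioo, ← intervalIntegral.integral_of_le (by positivity),
          intervalIntegral.integral_add i1 i2, e1, e2]; ring
    _ ≤ 4 / ε := by
        have : (π / 2) ^ ε ≤ 2 := by
          calc (π / 2) ^ ε ≤ (π / 2) ^ (1 : ℝ) :=
                Real.rpow_le_rpow_of_exponent_le (by linarith [Real.pi_gt_three]) h1
            _ ≤ 2 := by rw [Real.rpow_one]; linarith [Real.pi_le_four]
        rw [← mul_div_assoc]
        gcongr
        linarith

theorem Kker_nonneg {θ : ℝ} (h : θ ∈ Icc 0 (π / 2)) : 0 ≤ Kker θ := by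
  have h1 := Real.sin_nonneg_of_nonneg_of_le_pi h.1 (by linarith [h.2, Real.pi_pos])
  unfold Kker
  positivity

theorem Kker_le {θ : ℝ} (h : θ ∈ Icc 0 (π / 2)) : Kker θ ≤ 3 / 2 := by
  have h1 := Real.sin_nonneg_of_nonneg_of_le_pi h.1 (by linarith [h.2, Real.pi_pos])
  have h2 := Real.cos_nonneg_of_neg_pi_div_two_le_of_le (x := θ)
    (by linarith [h.1, Real.pi_pos]) h.2
  unfold Kker
  have h3 := Real.sin_sq_add_cos_sq θ
  have h4 : Real.sin θ * Real.cos θ ≤ 1 / 2 := by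
    nlinarith [sq_nonneg (Real.sin θ - Real.cos θ)]
  have h5 := Real.cos_le_one θ
  nlinarith [mul_nonneg h1 h2]

theorem continuous_Kker : Continuous Kker := by
  unfold Kker; fun_prop

theorem integral_Kker : ∫ θ in Icc 0 (π / 2), Kker θ = 1 := by
  rw [integral_Icc_eq_integral_Ioc, ← intervalIntegral.integral_of_le (by positivity)]
  have h : ∀ θ ∈ uIcc 0 (π / 2), HasDerivAt (fun θ => -Real.cos θ ^ 3) (Kker θ) θ := by
    intro θ _
    refine ((Real.hasDerivAt_cos θ).pow 3).neg.congr_deriv ?_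
    unfold Kker; push_cast; ring
  rw [intervalIntegral.integral_eq_sub_of_hasDerivAt h (continuous_Kker.intervalIntegrable _ _)]
  simp

theorem integral_Kker_sq_le : ∫ θ in Icc 0 (π / 2), Kker θ ^ 2 ≤ 3 / 2 := by
  calc _ ≤ ∫ θ in Icc 0 (π / 2), 3 / 2 * Kker θ := by
        refine setIntegral_mono_on ?_ ?_ measurableSet_Icc ?_
        · exact (continuous_Kker.pow 2).integrableOn_Icc
        · exact (continuous_const.mul continuous_Kker).integrableOn_Icc
        · intro θ hθ
          nlinarith [Kker_nonneg hθ, Kker_le hθ]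
    _ = 3 / 2 := by rw [integral_const_mul, integral_Kker]; norm_num

theorem continuous_Gam {α : ℝ} (hα : 0 < α) : Continuous (Gam α) := by
  unfold Gam
  exact Continuous.rpow_const (by fun_prop) fun x => Or.inr (by positivity)

theorem sin_mul_cos_sq_mem {θ : ℝ} (h : θ ∈ Icc 0 (π / 2)) :
    0 ≤ Real.sin θ * Real.cos θ ^ 2 ∧ Real.sin θ * Real.cos θ ^ 2 ≤ 1 := by
  have h1 := Kker_nonneg h
  have h2 := Kker_le h
  unfold Kker at h1 h2
  constructor <;> nlinarith

theorem Gam_nonneg {α θ : ℝ} (h : θ ∈ Icc 0 (π / 2)) : 0 ≤ Gam α θ :=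
  Real.rpow_nonneg (sin_mul_cos_sq_mem h).1 _

theorem Gam_le_one {α θ : ℝ} (hα : 0 < α) (h : θ ∈ Icc 0 (π / 2)) : Gam α θ ≤ 1 :=
  Real.rpow_le_one (sin_mul_cos_sq_mem h).1 (sin_mul_cos_sq_mem h).2 (by positivity)

theorem sin_mul_cos_sq_pos {θ : ℝ} (h : θ ∈ Ioo 0 (π / 2)) :
    0 < Real.sin θ * Real.cos θ ^ 2 := by
  have h1 := Real.sin_pos_of_pos_of_lt_pi h.1 (by linarith [h.2, Real.pi_pos])
  have h2 := Real.cos_pos_of_mem_Ioo (x := θ) ⟨by linarith [h.1, Real.pi_pos], h.2⟩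
  positivity

theorem half_le_cGam {α : ℝ} (hα : 0 < α) (hα' : α < 1 / 10 ^ 14) : 1 / 2 ≤ cGam α := by
  have h : ∀ θ ∈ Ioo 0 (π / 2), Kker θ - α ≤ Gam α θ * Kker θ := by
    intro θ hθ
    have hx := sin_mul_cos_sq_pos hθ
    have hx1 := (sin_mul_cos_sq_mem (Ioo_subset_Icc_self hθ)).2
    have hK : Kker θ = 3 * (Real.sin θ * Real.cos θ ^ 2) := by unfold Kker; ring
    rw [hK]
    unfold Gam
    set x := Real.sin θ * Real.cos θ ^ 2
    have h1 : 1 + Real.log x * (α / 3) ≤ x ^ (α / 3) := by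
      rw [Real.rpow_def_of_pos hx]
      linarith [Real.add_one_le_exp (Real.log x * (α / 3))]
    have h2 : 1 - x⁻¹ ≤ Real.log x := Real.one_sub_inv_le_log_of_pos hx
    have h3 : x * x⁻¹ = 1 := mul_inv_cancel₀ hx.ne'
    have h4 : 1 + (1 - x⁻¹) * (α / 3) ≤ x ^ (α / 3) := by nlinarith
    have h5 := mul_le_mul_of_nonneg_right h4 (by positivity : 0 ≤ 3 * x)
    have h6 : (1 + (1 - x⁻¹) * (α / 3)) * (3 * x) = 3 * x + α * x - α * (x * x⁻¹) := by ring
    rw [h6, h3] at h5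
    nlinarith
  have i1 : IntegrableOn (fun θ => Kker θ - α) (Ioo 0 (π / 2)) :=
    (continuous_Kker.sub continuous_const).integrableOn_Icc.mono_set Ioo_subset_Icc_self
  have i2 : IntegrableOn (fun θ => Gam α θ * Kker θ) (Ioo 0 (π / 2)) :=
    ((continuous_Gam hα).mul continuous_Kker).integrableOn_Icc.mono_set Ioo_subset_Icc_self
  have h1 := setIntegral_mono_on i1 i2 measurableSet_Ioo h
  rw [← integral_Icc_eq_integral_Ioo, ← integral_Icc_eq_integral_Ioo, integral_sub
    continuous_Kker.integrableOn_Icc continuous_const.integrableOn_Icc, integral_Kker] at h1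
  simp only [integral_const, MeasurableSet.univ, measureReal_restrict_apply, univ_inter,
    Real.volume_real_Icc, sub_zero, smul_eq_mul] at h1
  rw [max_eq_left (by positivity)] at h1
  unfold cGam
  nlinarith [Real.pi_le_four]

theorem Gam_sq_mul_rpow_le {α θ : ℝ} (hα : 0 < α) (h : θ ∈ Ioo 0 (π / 2)) :
    Gam α θ ^ 2 * Real.sin (2 * θ) ^ (-(1 + α / 10)) ≤ Real.sin (2 * θ) ^ (17 * α / 30 - 1) := by
  have hs := Real.sin_pos_of_pos_of_lt_pi h.1 (by linarith [h.2, Real.pi_pos])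
  have hc := Real.cos_pos_of_mem_Ioo (x := θ) ⟨by linarith [h.1, Real.pi_pos], h.2⟩
  have hS := sin_two_mul_pos h
  have h1 : Real.sin θ * Real.cos θ ^ 2 ≤ Real.sin (2 * θ) := by
    rw [Real.sin_two_mul]
    nlinarith [mul_pos hs hc, Real.cos_le_one θ]
  have h2 : Gam α θ ≤ Real.sin (2 * θ) ^ (α / 3) :=
    Real.rpow_le_rpow (sin_mul_cos_sq_pos h).le h1 (by positivity)
  have h3 : Gam α θ ^ 2 ≤ (Real.sin (2 * θ) ^ (α / 3)) ^ 2 :=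
    pow_le_pow_left₀ (Gam_nonneg (Ioo_subset_Icc_self h)) h2 2
  calc _ ≤ (Real.sin (2 * θ) ^ (α / 3)) ^ 2 * Real.sin (2 * θ) ^ (-(1 + α / 10)) :=
        mul_le_mul_of_nonneg_right h3 (Real.rpow_nonneg hS.le _)
    _ = _ := by
        rw [pow_two, ← Real.rpow_add hS, ← Real.rpow_add hS]
        congr 1; ring

theorem Dth_Gam {α θ : ℝ} (h : θ ∈ Ioo 0 (π / 2)) :
    ∃ d, HasDerivAt (Gam α) d θ ∧ Real.sin (2 * θ) * d
      = α / 3 * (2 * Real.cos θ ^ 2 - 4 * Real.sin θ ^ 2) * Gam α θ := by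
  have hs := Real.sin_pos_of_pos_of_lt_pi h.1 (by linarith [h.2, Real.pi_pos])
  have hc := Real.cos_pos_of_mem_Ioo (x := θ) ⟨by linarith [h.1, Real.pi_pos], h.2⟩
  have hx := sin_mul_cos_sq_pos h
  refine ⟨_, ((Real.hasDerivAt_sin θ).mul ((Real.hasDerivAt_cos θ).pow 2)).rpow_const
    (p := α / 3) (Or.inl hx.ne'), ?_⟩
  simp only [Pi.mul_apply, Pi.pow_apply]
  rw [Real.rpow_sub_one hx.ne']
  unfold Gam
  rw [Real.sin_two_mul]
  field_simp
  push_cast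
  ring

theorem setIntegral_Icc_eq_intervalIntegral {a b : ℝ} (hab : a ≤ b) (F : ℝ → ℝ) :
    ∫ x in Icc a b, F x = ∫ x in a..b, F x := by
  rw [integral_Icc_eq_integral_Ioc, intervalIntegral.integral_of_le hab]

theorem abs_primitive_le_sin {m : ℝ → ℝ} (hm : Continuous m)
    (hb : ∀ θ ∈ Icc 0 (π / 2), |m θ| ≤ 3) (h0 : ∫ θ in Icc 0 (π / 2), m θ = 0)
    {θ : ℝ} (hθ : θ ∈ Icc 0 (π / 2)) :
    |∫ t in (0 : ℝ)..θ, m t| ≤ 3 * Real.sin (2 * θ) := by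
  rw [setIntegral_Icc_eq_intervalIntegral (by positivity)] at h0
  have hadd := intervalIntegral.integral_add_adjacent_intervals
    (hm.intervalIntegrable (μ := volume) 0 θ) (hm.intervalIntegrable θ (π / 2))
  rw [h0] at hadd
  have h1 : |∫ t in (0 : ℝ)..θ, m t| ≤ 3 * |θ - 0| := by
    rw [← Real.norm_eq_abs]
    refine intervalIntegral.norm_integral_le_of_norm_le_const fun t ht => ?_
    rw [uIoc_of_le hθ.1] at ht
    exact hb t ⟨ht.1.le, ht.2.trans hθ.2⟩
  have h2 : |∫ t in θ..(π / 2), m t| ≤ 3 * |π / 2 - θ| := by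
    rw [← Real.norm_eq_abs]
    refine intervalIntegral.norm_integral_le_of_norm_le_const fun t ht => ?_
    rw [uIoc_of_le hθ.2] at ht
    exact hb t ⟨hθ.1.trans ht.1.le, ht.2⟩
  rw [sub_zero, abs_of_nonneg hθ.1] at h1
  rw [abs_of_nonneg (by linarith [hθ.2] : 0 ≤ π / 2 - θ)] at h2
  have h3 : |∫ t in θ..(π / 2), m t| = |∫ t in (0 : ℝ)..θ, m t| := by
    rw [show ∫ t in θ..(π / 2), m t = -∫ t in (0 : ℝ)..θ, m t by linarith, abs_neg]
  rcases min_le_sin_two_mul hθ with h | h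
  · linarith
  · linarith

theorem sq_integral_mul_mean_zero_le {m u u' : ℝ → ℝ} (hm : Continuous m)
    (hb : ∀ θ ∈ Icc 0 (π / 2), |m θ| ≤ 3) (h0 : ∫ θ in Icc 0 (π / 2), m θ = 0)
    (hu : ∀ θ, HasDerivAt u (u' θ) θ) (hu' : Continuous u') :
    (∫ θ in Icc 0 (π / 2), m θ * u θ) ^ 2
      ≤ 18 * ∫ θ in Icc 0 (π / 2), (Real.sin (2 * θ) * u' θ) ^ 2 := by
  set M : ℝ → ℝ := fun θ => ∫ t in (0 : ℝ)..θ, m t with hM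
  have hMd : ∀ θ, HasDerivAt M (m θ) θ := fun θ => (hm.integral_hasStrictDerivAt 0 θ).hasDerivAt
  have hMc : Continuous M := continuous_iff_continuousAt.2 fun θ => (hMd θ).continuousAt
  have e : ∫ θ in Icc 0 (π / 2), m θ * u θ = -∫ θ in Icc 0 (π / 2), u' θ * M θ := by
    have hM1 : M (π / 2) = 0 := by
      rw [← h0, setIntegral_Icc_eq_intervalIntegral (by positivity)]
    have hM0 : M 0 = 0 := by simp [hM]
    have := intervalIntegral.integral_mul_deriv_eq_deriv_mul (a := 0) (b := π / 2)
      (fun θ _ => hu θ) (fun θ _ => hMd θ) (hu'.intervalIntegrable _ _)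
      (hm.intervalIntegrable _ _)
    rw [hM1, hM0] at this
    rw [setIntegral_Icc_eq_intervalIntegral (by positivity),
      setIntegral_Icc_eq_intervalIntegral (by positivity)]
    simp only [mul_comm (m _)]
    rw [this]; ring
  have h1 : |∫ θ in Icc 0 (π / 2), u' θ * M θ|
      ≤ ∫ θ in Icc 0 (π / 2), 3 * |Real.sin (2 * θ) * u' θ| := by
    refine (abs_integral_le_integral_abs).trans ?_
    refine setIntegral_mono_on ?_ ?_ measurableSet_Icc fun θ hθ => ?_
    · exact (hu'.mul hMc).abs.integrableOn_Icc
    · exact Continuous.integrableOn_Icc (by fun_prop)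
    · have := abs_primitive_le_sin hm hb h0 hθ
      rw [abs_mul, abs_mul, abs_of_nonneg (sin_two_mul_nonneg hθ)]
      nlinarith [abs_nonneg (u' θ)]
  have h2 := sq_integral_mul_le (μ := volume.restrict (Icc 0 (π / 2)))
    (F := fun _ => (3 : ℝ)) (G := fun θ => |Real.sin (2 * θ) * u' θ|)
    (Continuous.integrableOn_Icc (by fun_prop)) (Continuous.integrableOn_Icc (by fun_prop))
    (Continuous.integrableOn_Icc (by fun_prop))
  simp only [integral_const, MeasurableSet.univ, measureReal_restrict_apply, univ_inter,
    Real.volume_real_Icc, sub_zero, smul_eq_mul, sq_abs] at h2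
  rw [max_eq_left (by positivity)] at h2
  rw [e, neg_sq, ← sq_abs]
  have hI : 0 ≤ ∫ θ in Icc 0 (π / 2), (Real.sin (2 * θ) * u' θ) ^ 2 :=
    integral_nonneg fun θ => sq_nonneg _
  have h3 := pow_le_pow_left₀ (abs_nonneg _) h1 2
  nlinarith [Real.pi_le_four]

theorem integral_angular_transport {p : ℝ} (hp : 0 < p) {u u' : ℝ → ℝ}
    (hu : ∀ θ, HasDerivAt u (u' θ) θ) (hu' : Continuous u') :
    ∫ θ in Icc 0 (π / 2), (2 * Real.cos (2 * θ) * u θ ^ 2 + Real.sin (2 * θ) * u θ * u' θ)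
        * Real.sin (2 * θ) ^ p
      = (1 - p) * ∫ θ in Icc 0 (π / 2), Real.cos (2 * θ) * u θ ^ 2 * Real.sin (2 * θ) ^ p := by
  have huc : Continuous u := continuous_iff_continuousAt.2 fun θ => (hu θ).continuousAt
  have hSp : Continuous fun θ : ℝ => Real.sin (2 * θ) ^ p :=
    Continuous.rpow_const (by fun_prop) fun _ => Or.inr hp.le
  have hd : ∀ θ ∈ uIcc 0 (π / 2), HasDerivAt (fun θ => u θ ^ 2 * Real.sin (2 * θ) ^ (p + 1) / 2)
      (((2 * Real.cos (2 * θ) * u θ ^ 2 + Real.sin (2 * θ) * u θ * u' θ)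
        * Real.sin (2 * θ) ^ p)
        - (1 - p) * (Real.cos (2 * θ) * u θ ^ 2 * Real.sin (2 * θ) ^ p)) θ := by
    intro θ hθ
    rw [uIcc_of_le (by positivity)] at hθ
    have h1 : HasDerivAt (fun θ : ℝ => Real.sin (2 * θ)) (Real.cos (2 * θ) * 2) θ := by
      simpa using ((hasDerivAt_id θ).const_mul 2).sin
    have h2 := h1.rpow_const (p := p + 1) (Or.inr (by linarith))
    refine ((((hu θ).pow 2).mul h2).div_const 2).congr_deriv ?_
    have h3 : Real.sin (2 * θ) ^ (p + 1) = Real.sin (2 * θ) ^ p * Real.sin (2 * θ) :=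
      Real.rpow_add_one' (sin_two_mul_nonneg hθ) (by linarith)
    simp only [Pi.pow_apply, h3, add_sub_cancel_right]
    push_cast
    ring
  have c1 : Continuous fun θ => (2 * Real.cos (2 * θ) * u θ ^ 2
      + Real.sin (2 * θ) * u θ * u' θ) * Real.sin (2 * θ) ^ p := by fun_prop
  have c2 : Continuous fun θ => Real.cos (2 * θ) * u θ ^ 2 * Real.sin (2 * θ) ^ p := by fun_prop
  have c3 : Continuous fun θ => (1 - p) * (Real.cos (2 * θ) * u θ ^ 2 * Real.sin (2 * θ) ^ p) := by
    fun_prop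
  have h := intervalIntegral.integral_eq_sub_of_hasDerivAt hd
    ((c1.sub c3).intervalIntegrable _ _)
  rw [intervalIntegral.integral_sub (c1.intervalIntegrable _ _)
    (c3.intervalIntegrable _ _), intervalIntegral.integral_const_mul] at h
  have hπ : 2 * (π / 2) = π := by ring
  simp only [hπ, Real.sin_pi, mul_zero, Real.sin_zero,
    Real.zero_rpow (by linarith : p + 1 ≠ 0), zero_div, sub_zero] at h
  rw [setIntegral_Icc_eq_intervalIntegral (by positivity),
    setIntegral_Icc_eq_intervalIntegral (by positivity)]
  linarith

theorem hardy_inequality {a b : ℝ} (ha : 0 < a) (hab : a ≤ b) {l κ : ℝ → ℝ}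
    (hl : ∀ z, HasDerivAt l (-κ z) z) (hκ : Continuous κ) (hla : l a = 0) (hlb : l b = 0) :
    ∫ z in Icc a b, (l z / z) ^ 2 ≤ 4 * ∫ z in Icc a b, κ z ^ 2 := by
  have hlc : Continuous l := continuous_iff_continuousAt.2 fun θ => (hl θ).continuousAt
  have hne : ∀ z ∈ Icc a b, z ≠ 0 := fun z hz => (ha.trans_le hz.1).ne'
  have c0 : ContinuousOn (fun z => l z / z) (Icc a b) :=
    hlc.continuousOn.div continuousOn_id hne
  have c1 : IntegrableOn (fun z => (l z / z) ^ 2) (Icc a b) :=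
    (c0.pow 2).integrableOn_Icc
  have c2 : IntegrableOn (fun z => l z / z * κ z) (Icc a b) :=
    (c0.mul hκ.continuousOn).integrableOn_Icc
  have c3 : IntegrableOn (fun z => κ z ^ 2) (Icc a b) := (hκ.pow 2).integrableOn_Icc
  have hd : ∀ z ∈ uIcc a b, HasDerivAt (fun z => -(l z ^ 2 / z))
      (2 * (l z / z * κ z) + (l z / z) ^ 2) z := by
    intro z hz
    rw [uIcc_of_le hab] at hz
    refine (((hl z).pow 2).div (hasDerivAt_id z) (hne z hz)).neg.congr_deriv ?_
    have := hne z hz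
    simp only [Pi.pow_apply, id]
    field_simp
    push_cast
    ring
  have h := intervalIntegral.integral_eq_sub_of_hasDerivAt hd (by
    rw [intervalIntegrable_iff_integrableOn_Icc_of_le hab]
    exact (c2.const_mul 2).add c1)
  rw [← setIntegral_Icc_eq_intervalIntegral hab, integral_add (c2.const_mul 2) c1,
    integral_const_mul, hla, hlb] at h
  have h2 : -∫ z in Icc a b, l z / z * κ z
      ≤ 1 / 4 * (∫ z in Icc a b, (l z / z) ^ 2) + ∫ z in Icc a b, κ z ^ 2 := by
    rw [← integral_neg, ← integral_const_mul, ← integral_add (c1.const_mul _) c3]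
    refine integral_mono c2.neg ((c1.const_mul _).add c3) fun z => ?_
    nlinarith [sq_nonneg (l z / z / 2 + κ z)]
  norm_num at h
  linarith

theorem integral_mul_weight_nonpos {a b : ℝ} (ha : 0 < a) (hab : a ≤ b) {l κ : ℝ → ℝ}
    (hl : ∀ z, HasDerivAt l (-κ z) z) (hκ : Continuous κ) (hla : l a = 0) (hlb : l b = 0) :
    ∫ z in Icc a b, l z * κ z * ((1 + z) ^ 2 / z ^ 2) ≤ 0 := by
  have hlc : Continuous l := continuous_iff_continuousAt.2 fun θ => (hl θ).continuousAt
  have hpos : ∀ z ∈ Icc a b, 0 < z := fun z hz => ha.trans_le hz.1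
  have c1 : IntegrableOn (fun z => l z * κ z * ((1 + z) ^ 2 / z ^ 2)) (Icc a b) := by
    refine ContinuousOn.integrableOn_Icc (ContinuousOn.mul (by fun_prop) (ContinuousOn.div
      (by fun_prop) (by fun_prop) fun z hz => (pow_pos (hpos z hz) 2).ne'))
  have c2 : IntegrableOn (fun z => l z ^ 2 * ((1 + z) / z ^ 3)) (Icc a b) := by
    refine ContinuousOn.integrableOn_Icc (ContinuousOn.mul (by fun_prop) (ContinuousOn.div
      (by fun_prop) (by fun_prop) fun z hz => (pow_pos (hpos z hz) 3).ne'))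
  have hd : ∀ z ∈ uIcc a b, HasDerivAt (fun z => -(l z ^ 2 * ((1 + z) ^ 2 / z ^ 2)))
      (2 * (l z * κ z * ((1 + z) ^ 2 / z ^ 2)) + 2 * (l z ^ 2 * ((1 + z) / z ^ 3))) z := by
    intro z hz
    rw [uIcc_of_le hab] at hz
    have hz0 := (hpos z hz).ne'
    refine (((hl z).pow 2).mul ((((hasDerivAt_id z).const_add 1).pow 2).div
      ((hasDerivAt_id z).pow 2) (pow_ne_zero 2 hz0))).neg.congr_deriv ?_
    simp only [Pi.pow_apply, Pi.div_apply, id]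
    field_simp
    push_cast
    ring
  have h := intervalIntegral.integral_eq_sub_of_hasDerivAt hd (by
    rw [intervalIntegrable_iff_integrableOn_Icc_of_le hab]
    exact (c1.const_mul 2).add (c2.const_mul 2))
  rw [← setIntegral_Icc_eq_intervalIntegral hab, integral_add (c1.const_mul 2) (c2.const_mul 2),
    integral_const_mul, integral_const_mul, hla, hlb] at h
  have h2 : 0 ≤ ∫ z in Icc a b, l z ^ 2 * ((1 + z) / z ^ 3) :=
    setIntegral_nonneg measurableSet_Icc fun z hz => by have := hpos z hz; positivity
  norm_num at h
  linarith

/-- Lebesgue measure on the rectangle `[a,b] × [0,π/2]`. -/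
def rect (a b : ℝ) : Measure (ℝ × ℝ) :=
  (volume.restrict (Icc a b)).prod (volume.restrict (Icc 0 (π / 2)))

theorem rect_eq (a b : ℝ) : rect a b = volume.restrict (Icc a b ×ˢ Icc 0 (π / 2)) := by
  rw [rect, Measure.prod_restrict, Measure.volume_eq_prod]

theorem integrable_rect {a b : ℝ} {φ : ℝ × ℝ → ℝ} {ρ : ℝ → ℝ}
    (hφ : ContinuousOn φ (Icc a b ×ˢ Icc 0 (π / 2))) (hρ : IntegrableOn ρ (Icc 0 (π / 2))) :
    Integrable (fun p => φ p * ρ p.2) (rect a b) := by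
  obtain ⟨C, hC⟩ := (isCompact_Icc.prod isCompact_Icc).exists_bound_of_continuousOn hφ
  have h1 : Integrable (fun p : ℝ × ℝ => (1 : ℝ) * ρ p.2) (rect a b) :=
    Integrable.mul_prod (integrable_const 1) hρ
  simp only [one_mul] at h1
  have hm : MeasurableSet (Icc a b ×ˢ Icc 0 (π / 2)) := measurableSet_Icc.prod measurableSet_Icc
  refine h1.bdd_mul (c := C) ?_ ?_
  · rw [rect_eq]
    exact hφ.aestronglyMeasurable hm
  · rw [rect_eq]
    filter_upwards [ae_restrict_mem hm] with p hp using hC p hp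

theorem integrable_rect_of_continuousOn {a b : ℝ} {φ : ℝ × ℝ → ℝ}
    (hφ : ContinuousOn φ (Icc a b ×ˢ Icc 0 (π / 2))) : Integrable φ (rect a b) := by
  simpa using integrable_rect (ρ := fun _ => 1) hφ (integrable_const _)

theorem ae_rect {a b : ℝ} {P : ℝ × ℝ → Prop}
    (h : ∀ z ∈ Icc a b, ∀ θ ∈ Ioo 0 (π / 2), P (z, θ)) : ∀ᵐ p ∂rect a b, P p := by
  have e : rect a b = volume.restrict (Icc a b ×ˢ Ioo 0 (π / 2)) := by
    rw [rect, ← restrict_Ioo_eq_restrict_Icc (a := (0 : ℝ)), Measure.prod_restrict, Measure.volume_eq_prod]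
  rw [e]
  filter_upwards [ae_restrict_mem (measurableSet_Icc.prod measurableSet_Ioo)] with p hp
  exact h p.1 hp.1 p.2 hp.2

theorem integral_rect {a b : ℝ} {F : ℝ × ℝ → ℝ} (hF : Integrable F (rect a b)) :
    ∫ p, F p ∂rect a b = ∫ z in Icc a b, ∫ θ in Icc 0 (π / 2), F (z, θ) :=
  integral_prod F hF

theorem integral_rect_mul (a b : ℝ) (u v : ℝ → ℝ) :
    ∫ p, u p.1 * v p.2 ∂rect a b = (∫ z in Icc a b, u z) * ∫ θ in Icc 0 (π / 2), v θ :=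
  integral_prod_mul u v

theorem ip_eq_integral_rect {a b : ℝ} (ha : 0 < a) {A B : ℝ → ℝ → ℝ} {F : ℝ × ℝ → ℝ}
    (hF : Integrable F (rect a b))
    (h0 : ∀ z θ, z ∉ Icc a b → A z θ * B z θ = 0)
    (h : ∀ z ∈ Icc a b, ∀ θ ∈ Ioo 0 (π / 2), A z θ * B z θ = F (z, θ)) :
    ip A B = ∫ p, F p ∂rect a b := by
  rw [integral_rect hF, ip]
  have hsub : Icc a b ⊆ Ioi (0 : ℝ) := fun z hz => ha.trans_le hz.1
  rw [setIntegral_eq_of_subset_of_forall_sdiff_eq_zero measurableSet_Ioi hsub]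
  · refine setIntegral_congr_fun measurableSet_Icc fun z hz => ?_
    simp only [integral_Icc_eq_integral_Ioo]
    exact setIntegral_congr_fun measurableSet_Ioo fun θ hθ => h z hz θ hθ
  · intro z hz
    simp [h0 z _ hz.2]

theorem integral_rect_radial {a b : ℝ} (hab : a ≤ b) {k kz : ℝ → ℝ → ℝ} {ρ : ℝ → ℝ}
    (hd : ∀ z θ, HasDerivAt (fun s => k s θ) (kz z θ) z)
    (hk : Continuous (Function.uncurry k)) (hkz : Continuous (Function.uncurry kz))
    (hka : ∀ θ, k a θ = 0) (hkb : ∀ θ, k b θ = 0) (hρ : IntegrableOn ρ (Icc 0 (π / 2))) :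
    ∫ p, p.1 * k p.1 p.2 * kz p.1 p.2 * ρ p.2 ∂rect a b
      = -(1 / 2) * ∫ p, k p.1 p.2 ^ 2 * ρ p.2 ∂rect a b := by
  have hk1 : Continuous fun p : ℝ × ℝ => k p.1 p.2 := hk
  have hk2 : Continuous fun p : ℝ × ℝ => kz p.1 p.2 := hkz
  have i1 : Integrable (fun p : ℝ × ℝ => p.1 * k p.1 p.2 * kz p.1 p.2 * ρ p.2) (rect a b) :=
    integrable_rect (φ := fun p => p.1 * k p.1 p.2 * kz p.1 p.2)
      (by fun_prop) hρ
  have i2 : Integrable (fun p : ℝ × ℝ => k p.1 p.2 ^ 2 * ρ p.2) (rect a b) :=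
    integrable_rect (φ := fun p => k p.1 p.2 ^ 2) (by fun_prop) hρ
  rw [rect, integral_prod_symm _ i1, integral_prod_symm _ i2, ← integral_const_mul]
  refine integral_congr_ae (Eventually.of_forall fun θ => ?_)
  simp only [integral_mul_const]
  rw [← mul_assoc]
  congr 1
  have c1 : Continuous fun z => k z θ := hk1.comp (by fun_prop : Continuous fun z => (z, θ))
  have c2 : Continuous fun z => kz z θ := hk2.comp (by fun_prop : Continuous fun z => (z, θ))
  have h := intervalIntegral.integral_eq_sub_of_hasDerivAt (a := a) (b := b)
    (f := fun z => z * k z θ ^ 2) (f' := fun z => k z θ ^ 2 + 2 * (z * k z θ * kz z θ))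
    (fun z _ => ((hasDerivAt_id z).mul ((hd z θ).pow 2)).congr_deriv (by
      simp only [Pi.pow_apply, id]; push_cast; ring))
    (Continuous.intervalIntegrable (by fun_prop) _ _)
  rw [intervalIntegral.integral_add (Continuous.intervalIntegrable (by fun_prop) _ _)
    (Continuous.intervalIntegrable (by fun_prop) _ _), intervalIntegral.integral_const_mul,
    hka, hkb] at h
  rw [setIntegral_Icc_eq_intervalIntegral hab, setIntegral_Icc_eq_intervalIntegral hab]
  norm_num at h
  linarith

/-- A profile supported in `[a,b]` together with its partial derivatives:
`k = ∂_θ g`, `gz = ∂_z g`, `kz = ∂_z k`, `kt = ∂_θ k`. -/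
structure IsProfile (a b : ℝ) (g k gz kz kt : ℝ → ℝ → ℝ) : Prop where
  pos : 0 < a
  le : a ≤ b
  cg : Continuous (Function.uncurry g)
  ck : Continuous (Function.uncurry k)
  cgz : Continuous (Function.uncurry gz)
  ckz : Continuous (Function.uncurry kz)
  ckt : Continuous (Function.uncurry kt)
  dg : ∀ z θ, HasDerivAt (fun t => g z t) (k z θ) θ
  dgz : ∀ z θ, HasDerivAt (fun s => g s θ) (gz z θ) z
  dkz : ∀ z θ, HasDerivAt (fun s => k s θ) (kz z θ) z
  dkt : ∀ z θ, HasDerivAt (fun t => k z t) (kt z θ) θ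
  ga : ∀ θ, g a θ = 0
  gb : ∀ θ, g b θ = 0
  ka : ∀ θ, k a θ = 0
  kb : ∀ θ, k b θ = 0

theorem continuousOn_rect_fst {a b : ℝ} {u : ℝ → ℝ} (hu : ContinuousOn u (Icc a b)) :
    ContinuousOn (fun p : ℝ × ℝ => u p.1) (Icc a b ×ˢ Icc 0 (π / 2)) :=
  hu.comp continuousOn_fst fun _ hp => hp.1

theorem continuousOn_div_one_add {a b : ℝ} (ha : 0 < a) (C : ℝ) :
    ContinuousOn (fun z => C / (1 + z)) (Icc a b) :=
  ContinuousOn.div (by fun_prop) (by fun_prop) fun z hz => by linarith [hz.1]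

theorem integrableOn_rpow_of_nonneg {p : ℝ} (hp : 0 ≤ p) :
    IntegrableOn (fun θ : ℝ => Real.sin (2 * θ) ^ p) (Icc 0 (π / 2)) :=
  (Continuous.rpow_const (by fun_prop) fun _ => Or.inr hp).integrableOn_Icc

theorem energy_lower_bound {a b : ℝ} {g k gz kz kt : ℝ → ℝ → ℝ} (h : IsProfile a b g k gz kz kt)
    {α p : ℝ} (hα : 0 < α) (hp : 0 ≤ p) {q ρ : ℝ → ℝ} (hq : ContinuousOn q (Icc a b))
    (hρ : IntegrableOn ρ (Icc 0 (π / 2))) (hρ0 : ∀ θ ∈ Ioo 0 (π / 2), 0 ≤ ρ θ)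
    (hρp : ∀ θ ∈ Ioo 0 (π / 2), Real.sin (2 * θ) ^ 2 * ρ θ ≤ Real.sin (2 * θ) ^ p) :
    Integrable (fun x : ℝ × ℝ => (g x.1 x.2 + x.1 * gz x.1 x.2 + q x.1 * Gam α x.2
        - 3 / (1 + x.1) * (Real.sin (2 * x.2) * k x.1 x.2)) * g x.1 x.2 * ρ x.2) (rect a b) ∧
    2 / 5 * ∫ x, g x.1 x.2 ^ 2 * ρ x.2 ∂rect a b
        + ∫ x, q x.1 * Gam α x.2 * g x.1 x.2 * ρ x.2 ∂rect a b
        - 23 * ∫ x, k x.1 x.2 ^ 2 * Real.sin (2 * x.2) ^ p ∂rect a b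
      ≤ ∫ x, (g x.1 x.2 + x.1 * gz x.1 x.2 + q x.1 * Gam α x.2
        - 3 / (1 + x.1) * (Real.sin (2 * x.2) * k x.1 x.2)) * g x.1 x.2 * ρ x.2 ∂rect a b := by
  have cg : Continuous fun x : ℝ × ℝ => g x.1 x.2 := h.cg
  have ck : Continuous fun x : ℝ × ℝ => k x.1 x.2 := h.ck
  have cgz : Continuous fun x : ℝ × ℝ => gz x.1 x.2 := h.cgz
  have cΓ := continuous_Gam hα
  have cΓ2 : Continuous fun x : ℝ × ℝ => Gam α x.2 := cΓ.comp continuous_snd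
  have cq := continuousOn_rect_fst hq
  have cr := continuousOn_rect_fst (continuousOn_div_one_add (b := b) h.pos 3)
  have i1 : Integrable (fun x : ℝ × ℝ => g x.1 x.2 ^ 2 * ρ x.2) (rect a b) :=
    integrable_rect (φ := fun x => g x.1 x.2 ^ 2) (by fun_prop) hρ
  have i2 : Integrable (fun x : ℝ × ℝ => x.1 * g x.1 x.2 * gz x.1 x.2 * ρ x.2) (rect a b) :=
    integrable_rect (φ := fun x => x.1 * g x.1 x.2 * gz x.1 x.2) (by fun_prop) hρ
  have i3 : Integrable (fun x : ℝ × ℝ => q x.1 * Gam α x.2 * g x.1 x.2 * ρ x.2) (rect a b) :=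
    integrable_rect (φ := fun x => q x.1 * Gam α x.2 * g x.1 x.2)
      ((cq.mul cΓ2.continuousOn).mul cg.continuousOn) hρ
  have i4 : Integrable (fun x : ℝ × ℝ => 3 / (1 + x.1) * (Real.sin (2 * x.2) * k x.1 x.2)
      * g x.1 x.2 * ρ x.2) (rect a b) :=
    integrable_rect (φ := fun x => 3 / (1 + x.1) * (Real.sin (2 * x.2) * k x.1 x.2) * g x.1 x.2)
      ((cr.mul (Continuous.continuousOn (by fun_prop))).mul cg.continuousOn) hρ
  have i5 : Integrable (fun x : ℝ × ℝ => k x.1 x.2 ^ 2 * Real.sin (2 * x.2) ^ p) (rect a b) :=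
    integrable_rect (φ := fun x => k x.1 x.2 ^ 2) (by fun_prop) (integrableOn_rpow_of_nonneg hp)
  have e : (fun x : ℝ × ℝ => (g x.1 x.2 + x.1 * gz x.1 x.2 + q x.1 * Gam α x.2
        - 3 / (1 + x.1) * (Real.sin (2 * x.2) * k x.1 x.2)) * g x.1 x.2 * ρ x.2)
      = fun x => g x.1 x.2 ^ 2 * ρ x.2 + x.1 * g x.1 x.2 * gz x.1 x.2 * ρ x.2
        + q x.1 * Gam α x.2 * g x.1 x.2 * ρ x.2
        - 3 / (1 + x.1) * (Real.sin (2 * x.2) * k x.1 x.2) * g x.1 x.2 * ρ x.2 := by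
    ext x; ring
  have i12 : Integrable (fun x : ℝ × ℝ => g x.1 x.2 ^ 2 * ρ x.2
    + x.1 * g x.1 x.2 * gz x.1 x.2 * ρ x.2) (rect a b) := i1.add i2
  have i123 : Integrable (fun x : ℝ × ℝ => g x.1 x.2 ^ 2 * ρ x.2
    + x.1 * g x.1 x.2 * gz x.1 x.2 * ρ x.2 + q x.1 * Gam α x.2 * g x.1 x.2 * ρ x.2) (rect a b) :=
    i12.add i3
  have hT : ∫ x, 3 / (1 + x.1) * (Real.sin (2 * x.2) * k x.1 x.2) * g x.1 x.2 * ρ x.2 ∂rect a b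
      ≤ 1 / 10 * ∫ x, g x.1 x.2 ^ 2 * ρ x.2 ∂rect a b
        + 23 * ∫ x, k x.1 x.2 ^ 2 * Real.sin (2 * x.2) ^ p ∂rect a b := by
    rw [← integral_const_mul, ← integral_const_mul,
      ← integral_add (i1.const_mul _) (i5.const_mul _)]
    refine integral_mono_ae i4 ((i1.const_mul _).add (i5.const_mul _)) (ae_rect ?_)
    intro z hz θ hθ
    dsimp only
    have hz0 : 0 < z := h.pos.trans_le hz.1
    have h3 : 3 / (1 + z) ≤ 3 := by
      rw [div_le_iff₀ (by linarith)]; linarith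
    have h30 : 0 ≤ 3 / (1 + z) := by positivity
    set r := 3 / (1 + z)
    set s := Real.sin (2 * θ)
    have h4 : r * (s * k z θ) * g z θ ≤ 1 / 10 * g z θ ^ 2 + 23 * (s ^ 2 * k z θ ^ 2) := by
      have : r ^ 2 ≤ 9 := by nlinarith
      nlinarith [sq_nonneg (g z θ - 5 * (r * (s * k z θ))),
        mul_le_mul_of_nonneg_right this (sq_nonneg (s * k z θ)), sq_nonneg (s * k z θ)]
    have h5 := mul_le_mul_of_nonneg_right h4 (hρ0 θ hθ)
    have h6 := mul_le_mul_of_nonneg_left (hρp θ hθ) (sq_nonneg (k z θ))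
    nlinarith
  have hI := integral_rect_radial h.le h.dgz h.cg h.cgz h.ga h.gb hρ
  rw [e]
  refine ⟨i123.sub i4, ?_⟩
  rw [integral_sub i123 i4, integral_add i12 i3, integral_add i1 i2, hI]
  linarith

theorem integral_sq_potential_le {a b : ℝ} {g k gz kz kt : ℝ → ℝ → ℝ}
    (h : IsProfile a b g k gz kz kt) {l κ : ℝ → ℝ}
    (hl : ∀ z, HasDerivAt l (-κ z) z) (hκ : Continuous κ) (hla : l a = 0) (hlb : l b = 0)
    (hκg : ∀ z ∈ Icc a b, κ z = (∫ θ in Icc 0 (π / 2), g z θ * Kker θ) * (z / (1 + z) ^ 2)) :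
    ∫ z in Icc a b, (l z / z) ^ 2 ≤ ∫ x, g x.1 x.2 ^ 2 ∂rect a b := by
  have cg : Continuous fun x : ℝ × ℝ => g x.1 x.2 := h.cg
  have i1 : Integrable (fun x : ℝ × ℝ => g x.1 x.2 ^ 2) (rect a b) :=
    integrable_rect_of_continuousOn (by fun_prop)
  have h1 := hardy_inequality h.pos h.le hl hκ hla hlb
  have h2 : ∫ z in Icc a b, κ z ^ 2
      ≤ ∫ z in Icc a b, 1 / 4 * ∫ θ in Icc 0 (π / 2), g z θ ^ 2 := by
    refine setIntegral_mono_on (hκ.pow 2).integrableOn_Icc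
      (i1.integral_prod_left.const_mul _) measurableSet_Icc fun z hz => ?_
    have cz : Continuous fun θ => g z θ := cg.comp (by fun_prop : Continuous fun θ => (z, θ))
    have cK := continuous_Kker
    have h3 := sq_integral_mul_le (μ := volume.restrict (Icc 0 (π / 2))) (F := fun θ => g z θ)
      (G := Kker) (cz.pow 2).integrableOn_Icc (cK.pow 2).integrableOn_Icc
      (cz.mul cK).integrableOn_Icc
    have h4 := integral_Kker_sq_le
    have h5 : 0 ≤ ∫ θ in Icc 0 (π / 2), g z θ ^ 2 := integral_nonneg fun θ => sq_nonneg _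
    have hz0 : 0 < z := h.pos.trans_le hz.1
    have h6 : z / (1 + z) ^ 2 ≤ 1 / 4 := by
      rw [div_le_iff₀ (by positivity)]; nlinarith [sq_nonneg (1 - z)]
    have h7 : 0 ≤ z / (1 + z) ^ 2 := by positivity
    have h8 : (z / (1 + z) ^ 2) ^ 2 ≤ 1 / 16 := by nlinarith
    rw [hκg z hz, mul_pow]
    nlinarith [sq_nonneg (∫ θ in Icc 0 (π / 2), g z θ * Kker θ)]
  rw [integral_const_mul] at h2
  rw [integral_rect i1]
  linarith

theorem integral_inv_one_add_sq_le {a b : ℝ} (ha : 0 < a) (hab : a ≤ b) :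
    ∫ z in Icc a b, (1 / (1 + z)) ^ 2 ≤ 1 := by
  have hd : ∀ z ∈ uIcc a b, HasDerivAt (fun z : ℝ => -(1 / (1 + z))) ((1 / (1 + z)) ^ 2) z := by
    intro z hz
    rw [uIcc_of_le hab] at hz
    have hz0 : 1 + z ≠ 0 := by linarith [hz.1]
    refine ((hasDerivAt_const z (1 : ℝ)).div ((hasDerivAt_id z).const_add 1) hz0).neg.congr_deriv ?_
    simp only [id]
    field_simp
    ring
  have hi : IntervalIntegrable (fun z : ℝ => (1 / (1 + z)) ^ 2) volume a b := by
    rw [intervalIntegrable_iff_integrableOn_Icc_of_le hab]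
    exact ((continuousOn_div_one_add ha 1).pow 2).integrableOn_Icc
  rw [setIntegral_Icc_eq_intervalIntegral hab, intervalIntegral.integral_eq_sub_of_hasDerivAt hd hi]
  have h1 : 0 ≤ 1 / (1 + b) := by
    have : 0 < 1 + b := by linarith
    positivity
  have h2 : 1 / (1 + a) ≤ 1 := by
    rw [div_le_one (by linarith)]; linarith
  linarith

theorem integral_sq_coefficient_le {a b c β : ℝ} (hc : 1 / 2 ≤ c) (ha : 0 < a) (hab : a ≤ b)
    {l : ℝ → ℝ} (hl : Continuous l) :
    ∫ z in Icc a b, (2 / c * (-(l z / z) + β / (1 + z))) ^ 2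
      ≤ 32 * ((∫ z in Icc a b, (l z / z) ^ 2) + β ^ 2) := by
  have c0 : ContinuousOn (fun z => l z / z) (Icc a b) :=
    hl.continuousOn.div continuousOn_id fun z hz => (ha.trans_le hz.1).ne'
  have c1 : IntegrableOn (fun z => (l z / z) ^ 2) (Icc a b) := (c0.pow 2).integrableOn_Icc
  have c2 : IntegrableOn (fun z : ℝ => (1 / (1 + z)) ^ 2) (Icc a b) :=
    ((continuousOn_div_one_add ha 1).pow 2).integrableOn_Icc
  have c3 : IntegrableOn (fun z => (2 / c * (-(l z / z) + β / (1 + z))) ^ 2) (Icc a b) :=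
    ((continuousOn_const.mul (c0.neg.add (continuousOn_div_one_add ha β))).pow 2).integrableOn_Icc
  have hc2 : (2 / c) ^ 2 ≤ 16 := by
    have h1 : 2 / c ≤ 4 := by rw [div_le_iff₀ (by linarith)]; linarith
    have h2 : 0 ≤ 2 / c := by positivity
    nlinarith
  have h := setIntegral_mono_on c3 ((c1.const_mul 32).add (c2.const_mul (32 * β ^ 2)))
    measurableSet_Icc fun z hz => by
      rw [show β / (1 + z) = β * (1 / (1 + z)) by ring]
      simp only [Pi.add_apply]
      generalize l z / z = x
      generalize 1 / (1 + z) = y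
      rw [mul_pow]
      nlinarith [sq_nonneg (x + β * y), mul_le_mul_of_nonneg_right hc2 (sq_nonneg (-x + β * y))]
  simp only [Pi.add_apply] at h
  rw [integral_add (c1.const_mul 32) (c2.const_mul (32 * β ^ 2)), integral_const_mul,
    integral_const_mul] at h
  nlinarith [integral_inv_one_add_sq_le ha hab, sq_nonneg β]

theorem integral_nonlocal_weighted_ge {a b : ℝ} {g k gz kz kt : ℝ → ℝ → ℝ}
    (h : IsProfile a b g k gz kz kt) {α J : ℝ} (hα : 0 < α) {q ρ : ℝ → ℝ}
    (hq : ContinuousOn q (Icc a b)) (hρ : IntegrableOn ρ (Icc 0 (π / 2)))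
    (hρ0 : ∀ θ ∈ Ioo 0 (π / 2), 0 ≤ ρ θ) (hJ : ∫ θ in Icc 0 (π / 2), ρ θ ≤ J) :
    -(1 / 10 * ∫ x, g x.1 x.2 ^ 2 * ρ x.2 ∂rect a b) - 3 * ((∫ z in Icc a b, q z ^ 2) * J)
      ≤ ∫ x, q x.1 * Gam α x.2 * g x.1 x.2 * ρ x.2 ∂rect a b := by
  have cg : Continuous fun x : ℝ × ℝ => g x.1 x.2 := h.cg
  have cΓ2 : Continuous fun x : ℝ × ℝ => Gam α x.2 := (continuous_Gam hα).comp continuous_snd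
  have cq := continuousOn_rect_fst hq
  have i1 : Integrable (fun x : ℝ × ℝ => g x.1 x.2 ^ 2 * ρ x.2) (rect a b) :=
    integrable_rect (φ := fun x => g x.1 x.2 ^ 2) (by fun_prop) hρ
  have i2 : Integrable (fun x : ℝ × ℝ => q x.1 ^ 2 * ρ x.2) (rect a b) :=
    integrable_rect (φ := fun x => q x.1 ^ 2) (cq.pow 2) hρ
  have i3 : Integrable (fun x : ℝ × ℝ => q x.1 * Gam α x.2 * g x.1 x.2 * ρ x.2) (rect a b) :=
    integrable_rect (φ := fun x => q x.1 * Gam α x.2 * g x.1 x.2)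
      ((cq.mul cΓ2.continuousOn).mul cg.continuousOn) hρ
  have hQ : 0 ≤ ∫ z in Icc a b, q z ^ 2 := integral_nonneg fun z => sq_nonneg _
  have h2 : ∫ x, q x.1 ^ 2 * ρ x.2 ∂rect a b ≤ (∫ z in Icc a b, q z ^ 2) * J := by
    rw [integral_rect_mul a b (fun z => q z ^ 2) ρ]
    exact mul_le_mul_of_nonneg_left hJ hQ
  have h3 : ∫ x, -(1 / 10) * (g x.1 x.2 ^ 2 * ρ x.2) - 3 * (q x.1 ^ 2 * ρ x.2) ∂rect a b
      ≤ ∫ x, q x.1 * Gam α x.2 * g x.1 x.2 * ρ x.2 ∂rect a b := by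
    refine integral_mono_ae ((i1.const_mul _).sub (i2.const_mul _)) i3 (ae_rect ?_)
    intro z hz θ hθ
    dsimp only
    have hG0 := Gam_nonneg (α := α) (Ioo_subset_Icc_self hθ)
    have hG1 := Gam_le_one hα (Ioo_subset_Icc_self hθ)
    have h4 : -(1 / 10 * g z θ ^ 2) - 3 * q z ^ 2 ≤ q z * Gam α θ * g z θ := by
      have : Gam α θ ^ 2 ≤ 1 := by nlinarith
      nlinarith [sq_nonneg (g z θ + 5 * (q z * Gam α θ)),
        mul_le_mul_of_nonneg_left this (sq_nonneg (q z))]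
    have h5 := mul_le_mul_of_nonneg_right h4 (hρ0 θ hθ)
    nlinarith
  rw [integral_sub (i1.const_mul _) (i2.const_mul _), integral_const_mul,
    integral_const_mul] at h3
  linarith

theorem integral_radial_nonlocal_le {a b : ℝ} {g k gz kz kt : ℝ → ℝ → ℝ}
    (h : IsProfile a b g k gz kz kt) {α : ℝ} (hα : 0 < α) {l κ : ℝ → ℝ}
    (hl : ∀ z, HasDerivAt l (-κ z) z) (hκ : Continuous κ) (hla : l a = 0) (hlb : l b = 0)
    (hκg : ∀ z ∈ Icc a b, κ z = (∫ θ in Icc 0 (π / 2), g z θ * Kker θ) * (z / (1 + z) ^ 2)) :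
    4 * ∫ x, l x.1 / x.1 * (Gam α x.2 * g x.1 x.2) ∂rect a b
      ≤ 1 / 10 * (∫ z in Icc a b, (l z / z) ^ 2)
        + 720 * ∫ x, (Real.sin (2 * x.2) * k x.1 x.2) ^ 2 ∂rect a b := by
  have cg : Continuous fun x : ℝ × ℝ => g x.1 x.2 := h.cg
  have ck : Continuous fun x : ℝ × ℝ => k x.1 x.2 := h.ck
  have cΓ := continuous_Gam hα
  have cK := continuous_Kker
  have hlc : Continuous l := continuous_iff_continuousAt.2 fun θ => (hl θ).continuousAt
  have c0 : ContinuousOn (fun z => l z / z) (Icc a b) :=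
    hlc.continuousOn.div continuousOn_id fun z hz => (h.pos.trans_le hz.1).ne'
  set Γ₀ := ∫ θ in Icc 0 (π / 2), Gam α θ with hΓ₀
  have hΓ0 : 0 ≤ Γ₀ := setIntegral_nonneg measurableSet_Icc fun θ hθ => Gam_nonneg hθ
  have hΓ1 : Γ₀ ≤ 2 := by
    have i0 : IntegrableOn (Gam α) (Icc 0 (π / 2)) volume := cΓ.integrableOn_Icc
    have i1 : IntegrableOn (fun _ : ℝ => (1 : ℝ)) (Icc 0 (π / 2)) volume :=
      continuous_const.integrableOn_Icc
    have := setIntegral_mono_on i0 i1 measurableSet_Icc fun θ hθ => Gam_le_one hα hθ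
    simp only [integral_const, MeasurableSet.univ, measureReal_restrict_apply, univ_inter,
      Real.volume_real_Icc, sub_zero, smul_eq_mul] at this
    rw [max_eq_left (by positivity)] at this
    linarith [Real.pi_le_four]
  set m : ℝ → ℝ := fun θ => Gam α θ - Γ₀ * Kker θ with hm
  have cm : Continuous m := by fun_prop
  have hmb : ∀ θ ∈ Icc 0 (π / 2), |m θ| ≤ 3 := by
    intro θ hθ
    have h1 := Gam_nonneg (α := α) hθ
    have h2 := Gam_le_one hα hθ
    have h3 := Kker_nonneg hθ
    have h4 := Kker_le hθ
    rw [abs_le]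
    constructor <;> simp only [hm] <;> nlinarith [mul_nonneg hΓ0 h3]
  have hm0 : ∫ θ in Icc 0 (π / 2), m θ = 0 := by
    simp only [hm]
    rw [integral_sub cΓ.integrableOn_Icc (cK.integrableOn_Icc.const_mul _), integral_const_mul,
      integral_Kker, ← hΓ₀]
    ring
  have iK : Integrable (fun x : ℝ × ℝ => l x.1 / x.1 * (g x.1 x.2 * Kker x.2)) (rect a b) :=
    integrable_rect_of_continuousOn ((continuousOn_rect_fst c0).mul
      (Continuous.continuousOn (by fun_prop)))
  have im : Integrable (fun x : ℝ × ℝ => l x.1 / x.1 * (m x.2 * g x.1 x.2)) (rect a b) :=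
    integrable_rect_of_continuousOn ((continuousOn_rect_fst c0).mul
      (Continuous.continuousOn (by fun_prop)))
  have iS : Integrable (fun x : ℝ × ℝ => (Real.sin (2 * x.2) * k x.1 x.2) ^ 2) (rect a b) :=
    integrable_rect_of_continuousOn (Continuous.continuousOn (by fun_prop))
  have e1 : ∫ x, l x.1 / x.1 * (Gam α x.2 * g x.1 x.2) ∂rect a b
      = Γ₀ * (∫ x, l x.1 / x.1 * (g x.1 x.2 * Kker x.2) ∂rect a b)
        + ∫ x, l x.1 / x.1 * (m x.2 * g x.1 x.2) ∂rect a b := by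
    rw [← integral_const_mul, ← integral_add (iK.const_mul _) im]
    congr 1; ext x
    simp only [hm]; ring
  have e2 : ∫ x, l x.1 / x.1 * (g x.1 x.2 * Kker x.2) ∂rect a b ≤ 0 := by
    rw [integral_rect iK]
    refine le_of_eq_of_le ?_ (integral_mul_weight_nonpos h.pos h.le hl hκ hla hlb)
    refine setIntegral_congr_fun measurableSet_Icc fun z hz => ?_
    have hz0 : 0 < z := h.pos.trans_le hz.1
    simp only [integral_const_mul, hκg z hz]
    field_simp
  have e3 : 4 * ∫ x, l x.1 / x.1 * (m x.2 * g x.1 x.2) ∂rect a b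
      ≤ 1 / 10 * (∫ z in Icc a b, (l z / z) ^ 2)
        + 720 * ∫ x, (Real.sin (2 * x.2) * k x.1 x.2) ^ 2 ∂rect a b := by
    have c1 : IntegrableOn (fun z => (l z / z) ^ 2) (Icc a b) := (c0.pow 2).integrableOn_Icc
    rw [integral_rect im, integral_rect iS, ← integral_const_mul, ← integral_const_mul,
      ← integral_const_mul, ← integral_add (c1.const_mul _) (iS.integral_prod_left.const_mul _)]
    refine setIntegral_mono_on (im.integral_prod_left.const_mul _)
      ((c1.const_mul _).add (iS.integral_prod_left.const_mul _)) measurableSet_Icc fun z _ => ?_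
    have h1 := sq_integral_mul_mean_zero_le cm hmb hm0 (h.dg z)
      (ck.comp (by fun_prop : Continuous fun θ => (z, θ)))
    simp only [integral_const_mul]
    nlinarith [sq_nonneg (l z / z - 20 * ∫ θ in Icc 0 (π / 2), m θ * g z θ)]
  have e4 := mul_nonpos_of_nonneg_of_nonpos hΓ0 e2
  rw [e1]
  linarith

theorem integral_nonlocal_ge {a b : ℝ} {g k gz kz kt : ℝ → ℝ → ℝ}
    (h : IsProfile a b g k gz kz kt) {α β c : ℝ} (hα : 0 < α) (hc : 1 / 2 ≤ c) {l κ : ℝ → ℝ}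
    (hl : ∀ z, HasDerivAt l (-κ z) z) (hκ : Continuous κ) (hla : l a = 0) (hlb : l b = 0)
    (hκg : ∀ z ∈ Icc a b, κ z = (∫ θ in Icc 0 (π / 2), g z θ * Kker θ) * (z / (1 + z) ^ 2))
    (hβ : β ^ 2 ≤ ∫ x, (Real.sin (2 * x.2) * k x.1 x.2) ^ 2 ∂rect a b) :
    -(1 / 5 * ∫ x, g x.1 x.2 ^ 2 ∂rect a b)
        - 800 * ∫ x, (Real.sin (2 * x.2) * k x.1 x.2) ^ 2 ∂rect a b
      ≤ ∫ x, 2 / c * (-(l x.1 / x.1) + β / (1 + x.1)) * Gam α x.2 * g x.1 x.2 ∂rect a b := by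
  have cg : Continuous fun x : ℝ × ℝ => g x.1 x.2 := h.cg
  have cΓ := continuous_Gam hα
  have hlc : Continuous l := continuous_iff_continuousAt.2 fun θ => (hl θ).continuousAt
  have c0 : ContinuousOn (fun z => l z / z) (Icc a b) :=
    hlc.continuousOn.div continuousOn_id fun z hz => (h.pos.trans_le hz.1).ne'
  have cΓg : Continuous fun x : ℝ × ℝ => Gam α x.2 * g x.1 x.2 := by fun_prop
  have i1 : Integrable (fun x : ℝ × ℝ => l x.1 / x.1 * (Gam α x.2 * g x.1 x.2)) (rect a b) :=
    integrable_rect_of_continuousOn ((continuousOn_rect_fst c0).mul cΓg.continuousOn)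
  have cb := continuousOn_div_one_add (b := b) h.pos β
  have i2 : Integrable (fun x : ℝ × ℝ => β / (1 + x.1) * (Gam α x.2 * g x.1 x.2)) (rect a b) :=
    integrable_rect_of_continuousOn ((continuousOn_rect_fst cb).mul cΓg.continuousOn)
  have i3 : Integrable (fun x : ℝ × ℝ => g x.1 x.2 ^ 2) (rect a b) :=
    integrable_rect_of_continuousOn (by fun_prop)
  have i4 : Integrable (fun x : ℝ × ℝ => (1 / (1 + x.1)) ^ 2) (rect a b) :=
    integrable_rect_of_continuousOn
      ((continuousOn_rect_fst (continuousOn_div_one_add h.pos 1)).pow 2)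
  have e4 : ∫ x : ℝ × ℝ, (1 / (1 + x.1)) ^ 2 ∂rect a b ≤ 2 := by
    have := integral_rect_mul a b (fun z => (1 / (1 + z)) ^ 2) (fun _ => 1)
    simp only [mul_one] at this
    rw [this]
    simp only [integral_const, MeasurableSet.univ, measureReal_restrict_apply, univ_inter,
      Real.volume_real_Icc, sub_zero, smul_eq_mul]
    rw [max_eq_left (by positivity)]
    nlinarith [integral_inv_one_add_sq_le h.pos h.le, Real.pi_le_four, Real.pi_pos]
  have e2 : -(1 / 40 * ∫ x, g x.1 x.2 ^ 2 ∂rect a b)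
      - 10 * β ^ 2 * ∫ x : ℝ × ℝ, (1 / (1 + x.1)) ^ 2 ∂rect a b
      ≤ ∫ x, β / (1 + x.1) * (Gam α x.2 * g x.1 x.2) ∂rect a b := by
    rw [← neg_mul, ← integral_const_mul, ← integral_const_mul,
      ← integral_sub (i3.const_mul _) (i4.const_mul _)]
    refine integral_mono_ae ((i3.const_mul _).sub (i4.const_mul _)) i2 (ae_rect ?_)
    intro z hz θ hθ
    dsimp only
    have hG0 := Gam_nonneg (α := α) (Ioo_subset_Icc_self hθ)
    have hG1 := Gam_le_one hα (Ioo_subset_Icc_self hθ)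
    have : Gam α θ ^ 2 ≤ 1 := by nlinarith
    rw [show β / (1 + z) = β * (1 / (1 + z)) by ring]
    generalize 1 / (1 + z) = y
    nlinarith [sq_nonneg (g z θ + 20 * (β * y * Gam α θ)),
      mul_le_mul_of_nonneg_left this (sq_nonneg (β * y))]
  have e1 := integral_radial_nonlocal_le h hα hl hκ hla hlb hκg
  have e3 := integral_sq_potential_le h hl hκ hla hlb hκg
  have e : ∫ x, 2 / c * (-(l x.1 / x.1) + β / (1 + x.1)) * Gam α x.2 * g x.1 x.2 ∂rect a b
      = 2 / c * (-(∫ x, l x.1 / x.1 * (Gam α x.2 * g x.1 x.2) ∂rect a b)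
        + ∫ x, β / (1 + x.1) * (Gam α x.2 * g x.1 x.2) ∂rect a b) := by
    have i1n : Integrable (fun x : ℝ × ℝ => -(l x.1 / x.1 * (Gam α x.2 * g x.1 x.2)))
      (rect a b) := i1.neg
    rw [← integral_neg, ← integral_add i1n i2, ← integral_const_mul]
    congr 1; ext x; ring
  have hc1 : 2 / c ≤ 4 := by rw [div_le_iff₀ (by linarith)]; linarith
  have hc0 : 0 ≤ 2 / c := by positivity
  have hI : 0 ≤ ∫ x, g x.1 x.2 ^ 2 ∂rect a b := integral_nonneg fun x => sq_nonneg _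
  have hS : 0 ≤ ∫ x, (Real.sin (2 * x.2) * k x.1 x.2) ^ 2 ∂rect a b :=
    integral_nonneg fun x => sq_nonneg _
  rw [e]
  set A := ∫ x, l x.1 / x.1 * (Gam α x.2 * g x.1 x.2) ∂rect a b
  set B := ∫ x, β / (1 + x.1) * (Gam α x.2 * g x.1 x.2) ∂rect a b
  have hB : -(1 / 40 * ∫ x, g x.1 x.2 ^ 2 ∂rect a b)
      - 20 * ∫ x, (Real.sin (2 * x.2) * k x.1 x.2) ^ 2 ∂rect a b ≤ B := by
    nlinarith [sq_nonneg β]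
  set D := -(1 / 20 * ∫ x, g x.1 x.2 ^ 2 ∂rect a b)
      - 200 * ∫ x, (Real.sin (2 * x.2) * k x.1 x.2) ^ 2 ∂rect a b with hD
  have h1 : D ≤ -A + B := by linarith
  have h2 : D ≤ 0 := by linarith
  nlinarith

theorem integral_transport_le {a b p : ℝ} {g k gz kz kt : ℝ → ℝ → ℝ}
    (h : IsProfile a b g k gz kz kt) (hp : 0 < p) (hp1 : p ≤ 1) :
    ∫ x, 3 / (1 + x.1) * (2 * Real.cos (2 * x.2) * k x.1 x.2 ^ 2
        + Real.sin (2 * x.2) * k x.1 x.2 * kt x.1 x.2) * Real.sin (2 * x.2) ^ p ∂rect a b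
      ≤ 3 * (1 - p) * ∫ x, k x.1 x.2 ^ 2 * Real.sin (2 * x.2) ^ p ∂rect a b := by
  have ck : Continuous fun x : ℝ × ℝ => k x.1 x.2 := h.ck
  have ckt : Continuous fun x : ℝ × ℝ => kt x.1 x.2 := h.ckt
  have cr := continuousOn_rect_fst (continuousOn_div_one_add (b := b) h.pos 3)
  have hρ := integrableOn_rpow_of_nonneg hp.le
  have i1 : Integrable (fun x : ℝ × ℝ => 3 / (1 + x.1) * (2 * Real.cos (2 * x.2) * k x.1 x.2 ^ 2
        + Real.sin (2 * x.2) * k x.1 x.2 * kt x.1 x.2) * Real.sin (2 * x.2) ^ p) (rect a b) :=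
    integrable_rect (φ := fun x => 3 / (1 + x.1) * (2 * Real.cos (2 * x.2) * k x.1 x.2 ^ 2
        + Real.sin (2 * x.2) * k x.1 x.2 * kt x.1 x.2))
      (cr.mul (Continuous.continuousOn (by fun_prop))) hρ
  have i2 : Integrable (fun x : ℝ × ℝ => k x.1 x.2 ^ 2 * Real.sin (2 * x.2) ^ p) (rect a b) :=
    integrable_rect (φ := fun x => k x.1 x.2 ^ 2) (by fun_prop) hρ
  rw [integral_rect i1, integral_rect i2, ← integral_const_mul]
  refine setIntegral_mono_on i1.integral_prod_left (i2.integral_prod_left.const_mul _)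
    measurableSet_Icc fun z hz => ?_
  have ckz : Continuous fun θ => k z θ := ck.comp (by fun_prop : Continuous fun θ => (z, θ))
  have hz0 : 0 < z := h.pos.trans_le hz.1
  have h1 := integral_angular_transport hp (h.dkt z)
    (ckt.comp (by fun_prop : Continuous fun θ => (z, θ)))
  have h2 : ∫ θ in Icc 0 (π / 2), Real.cos (2 * θ) * k z θ ^ 2 * Real.sin (2 * θ) ^ p
      ≤ ∫ θ in Icc 0 (π / 2), k z θ ^ 2 * Real.sin (2 * θ) ^ p := by
    have hSp : Continuous fun θ : ℝ => Real.sin (2 * θ) ^ p :=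
      Continuous.rpow_const (by fun_prop) fun _ => Or.inr hp.le
    refine setIntegral_mono_on (Continuous.integrableOn_Icc (by fun_prop))
      (Continuous.integrableOn_Icc (by fun_prop)) measurableSet_Icc fun θ hθ => ?_
    rw [mul_assoc]
    exact mul_le_of_le_one_left (mul_nonneg (sq_nonneg _)
      (Real.rpow_nonneg (sin_two_mul_nonneg hθ) _)) (Real.cos_le_one _)
  have h3 : 0 ≤ ∫ θ in Icc 0 (π / 2), k z θ ^ 2 * Real.sin (2 * θ) ^ p :=
    setIntegral_nonneg measurableSet_Icc fun θ hθ => mul_nonneg (sq_nonneg _)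
      (Real.rpow_nonneg (sin_two_mul_nonneg hθ) _)
  simp only [mul_assoc (3 / (1 + z))]
  rw [integral_const_mul, h1]
  have h4 : 3 / (1 + z) ≤ 3 := by rw [div_le_iff₀ (by linarith)]; linarith
  have h5 : 0 ≤ 3 / (1 + z) := by positivity
  have h6 : 0 ≤ 1 - p := by linarith
  calc _ ≤ 3 / (1 + z) * ((1 - p) * ∫ θ in Icc 0 (π / 2), k z θ ^ 2 * Real.sin (2 * θ) ^ p) := by
        gcongr
    _ ≤ 3 * ((1 - p) * ∫ θ in Icc 0 (π / 2), k z θ ^ 2 * Real.sin (2 * θ) ^ p) := by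
        gcongr
    _ = _ := by ring

theorem derivative_energy_lower_bound {a b α : ℝ} {g k gz kz kt : ℝ → ℝ → ℝ}
    (h : IsProfile a b g k gz kz kt) (hα : 0 < α) (hα' : α < 1 / 10 ^ 14)
    {q : ℝ → ℝ} (hq : ContinuousOn q (Icc a b)) :
    Integrable (fun x : ℝ × ℝ => (k x.1 x.2 ^ 2 + x.1 * k x.1 x.2 * kz x.1 x.2
        - 3 / (1 + x.1) * (2 * Real.cos (2 * x.2) * k x.1 x.2 ^ 2
          + Real.sin (2 * x.2) * k x.1 x.2 * kt x.1 x.2)) * Real.sin (2 * x.2) ^ (1 - α / 10)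
        + q x.1 * k x.1 x.2 * (α / 3 * (2 * Real.cos x.2 ^ 2 - 4 * Real.sin x.2 ^ 2)
          * Gam α x.2) * Real.sin (2 * x.2) ^ (-(α / 10))) (rect a b) ∧
    3 / 8 * (∫ x, k x.1 x.2 ^ 2 * Real.sin (2 * x.2) ^ (1 - α / 10) ∂rect a b)
        - 36 * α * ∫ z in Icc a b, q z ^ 2
      ≤ ∫ x, (k x.1 x.2 ^ 2 + x.1 * k x.1 x.2 * kz x.1 x.2
        - 3 / (1 + x.1) * (2 * Real.cos (2 * x.2) * k x.1 x.2 ^ 2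
          + Real.sin (2 * x.2) * k x.1 x.2 * kt x.1 x.2)) * Real.sin (2 * x.2) ^ (1 - α / 10)
        + q x.1 * k x.1 x.2 * (α / 3 * (2 * Real.cos x.2 ^ 2 - 4 * Real.sin x.2 ^ 2)
          * Gam α x.2) * Real.sin (2 * x.2) ^ (-(α / 10)) ∂rect a b := by
  have ck : Continuous fun x : ℝ × ℝ => k x.1 x.2 := h.ck
  have ckz : Continuous fun x : ℝ × ℝ => kz x.1 x.2 := h.ckz
  have ckt : Continuous fun x : ℝ × ℝ => kt x.1 x.2 := h.ckt
  have cΓ := continuous_Gam hα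
  have cr := continuousOn_rect_fst (continuousOn_div_one_add (b := b) h.pos 3)
  have cq := continuousOn_rect_fst hq
  norm_num at hα'
  set p := 1 - α / 10 with hp
  have hp0 : 0 < p := by linarith
  have hp1 : p ≤ 1 := by linarith
  have hρ := integrableOn_rpow_of_nonneg hp0.le
  have hσ : IntegrableOn (fun θ : ℝ => Real.sin (2 * θ) ^ (-(α / 10))) (Icc 0 (π / 2)) := by
    have := (sin_two_mul_rpow_integral hp0 hp1).1
    rwa [show p - 1 = -(α / 10) by ring] at this
  obtain ⟨hτ, hτJ⟩ := sin_two_mul_rpow_integral (ε := 17 * α / 30) (by positivity) (by linarith)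
  have i1 : Integrable (fun x : ℝ × ℝ => k x.1 x.2 ^ 2 * Real.sin (2 * x.2) ^ p) (rect a b) :=
    integrable_rect (φ := fun x => k x.1 x.2 ^ 2) (by fun_prop) hρ
  have i2 : Integrable (fun x : ℝ × ℝ => x.1 * k x.1 x.2 * kz x.1 x.2 * Real.sin (2 * x.2) ^ p)
      (rect a b) :=
    integrable_rect (φ := fun x => x.1 * k x.1 x.2 * kz x.1 x.2) (by fun_prop) hρ
  have i3 : Integrable (fun x : ℝ × ℝ => 3 / (1 + x.1) * (2 * Real.cos (2 * x.2) * k x.1 x.2 ^ 2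
        + Real.sin (2 * x.2) * k x.1 x.2 * kt x.1 x.2) * Real.sin (2 * x.2) ^ p) (rect a b) :=
    integrable_rect (φ := fun x => 3 / (1 + x.1) * (2 * Real.cos (2 * x.2) * k x.1 x.2 ^ 2
        + Real.sin (2 * x.2) * k x.1 x.2 * kt x.1 x.2))
      (cr.mul (Continuous.continuousOn (by fun_prop))) hρ
  have i4 : Integrable (fun x : ℝ × ℝ => q x.1 * k x.1 x.2 * (α / 3 * (2 * Real.cos x.2 ^ 2
      - 4 * Real.sin x.2 ^ 2) * Gam α x.2) * Real.sin (2 * x.2) ^ (-(α / 10))) (rect a b) :=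
    integrable_rect (φ := fun x => q x.1 * k x.1 x.2 * (α / 3 * (2 * Real.cos x.2 ^ 2
      - 4 * Real.sin x.2 ^ 2) * Gam α x.2))
      ((cq.mul ck.continuousOn).mul (Continuous.continuousOn (by fun_prop))) hσ
  have i5 : Integrable (fun x : ℝ × ℝ => q x.1 ^ 2 * Real.sin (2 * x.2) ^ (17 * α / 30 - 1))
      (rect a b) := integrable_rect (φ := fun x => q x.1 ^ 2) (cq.pow 2) hτ
  have i12 : Integrable (fun x : ℝ × ℝ => k x.1 x.2 ^ 2 * Real.sin (2 * x.2) ^ p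
      + x.1 * k x.1 x.2 * kz x.1 x.2 * Real.sin (2 * x.2) ^ p) (rect a b) := i1.add i2
  have i123 : Integrable (fun x : ℝ × ℝ => k x.1 x.2 ^ 2 * Real.sin (2 * x.2) ^ p
      + x.1 * k x.1 x.2 * kz x.1 x.2 * Real.sin (2 * x.2) ^ p
      - 3 / (1 + x.1) * (2 * Real.cos (2 * x.2) * k x.1 x.2 ^ 2
        + Real.sin (2 * x.2) * k x.1 x.2 * kt x.1 x.2) * Real.sin (2 * x.2) ^ p) (rect a b) :=
    i12.sub i3
  have hQ : 0 ≤ ∫ z in Icc a b, q z ^ 2 := integral_nonneg fun z => sq_nonneg _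
  have hH : 0 ≤ ∫ x, k x.1 x.2 ^ 2 * Real.sin (2 * x.2) ^ p ∂rect a b := by
    refine integral_nonneg_of_ae (ae_rect fun z _ θ hθ => ?_)
    exact mul_nonneg (sq_nonneg _) (Real.rpow_nonneg (sin_two_mul_pos hθ).le _)
  have e4 : -(1 / 10) * (∫ x, k x.1 x.2 ^ 2 * Real.sin (2 * x.2) ^ p ∂rect a b)
      - 5 * α ^ 2 * ∫ x, q x.1 ^ 2 * Real.sin (2 * x.2) ^ (17 * α / 30 - 1) ∂rect a b
      ≤ ∫ x, q x.1 * k x.1 x.2 * (α / 3 * (2 * Real.cos x.2 ^ 2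
      - 4 * Real.sin x.2 ^ 2) * Gam α x.2) * Real.sin (2 * x.2) ^ (-(α / 10)) ∂rect a b := by
    rw [← integral_const_mul, ← integral_const_mul,
      ← integral_sub (i1.const_mul _) (i5.const_mul _)]
    refine integral_mono_ae ((i1.const_mul _).sub (i5.const_mul _)) i4 (ae_rect ?_)
    intro z hz θ hθ
    dsimp only
    have hS := sin_two_mul_pos hθ
    have h1 := Gam_sq_mul_rpow_le hα hθ
    have h2 : Real.sin (2 * θ) ^ p = (Real.sin (2 * θ) ^ (p / 2)) ^ 2 := by
      rw [pow_two, ← Real.rpow_add hS]; congr 1; ring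
    have h3 : Real.sin (2 * θ) ^ (-(1 + α / 10))
        = (Real.sin (2 * θ) ^ (-(1 + α / 10) / 2)) ^ 2 := by
      rw [pow_two, ← Real.rpow_add hS]; congr 1; ring
    have h4 : Real.sin (2 * θ) ^ (-(α / 10))
        = Real.sin (2 * θ) ^ (p / 2) * Real.sin (2 * θ) ^ (-(1 + α / 10) / 2) := by
      rw [← Real.rpow_add hS]; congr 1; rw [hp]; ring
    rw [h3] at h1
    rw [h2, h4]
    have h5 := mul_le_mul_of_nonneg_left h1 (sq_nonneg (q z))
    have h6 : (2 * Real.cos θ ^ 2 - 4 * Real.sin θ ^ 2) ^ 2 ≤ 16 := by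
      have := Real.sin_sq_add_cos_sq θ
      nlinarith [sq_nonneg (Real.sin θ), sq_nonneg (Real.cos θ)]
    generalize 2 * Real.cos θ ^ 2 - 4 * Real.sin θ ^ 2 = d at *
    generalize Real.sin (2 * θ) ^ (17 * α / 30 - 1) = τ at *
    generalize Real.sin (2 * θ) ^ (p / 2) = x at *
    generalize Real.sin (2 * θ) ^ (-(1 + α / 10) / 2) = y at *
    have h7 := sq_nonneg (k z θ * x + 5 * (α / 3 * d * (q z * Gam α θ * y)))
    have h8 : (α / 3 * d * (q z * Gam α θ * y)) ^ 2
        ≤ α ^ 2 * (16 / 9) * (q z * Gam α θ * y) ^ 2 := by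
      rw [mul_pow]
      gcongr
      rw [mul_pow]
      nlinarith [sq_nonneg α]
    have h9 : α ^ 2 * (q z * Gam α θ * y) ^ 2 ≤ α ^ 2 * (q z ^ 2 * τ) := by
      gcongr
      linarith
    have h10 : 0 ≤ α ^ 2 * (q z * Gam α θ * y) ^ 2 := by positivity
    nlinarith
  have e5 : α ^ 2 * ∫ x, q x.1 ^ 2 * Real.sin (2 * x.2) ^ (17 * α / 30 - 1) ∂rect a b
      ≤ 120 / 17 * α * ∫ z in Icc a b, q z ^ 2 := by
    rw [integral_rect_mul a b (fun z => q z ^ 2) (fun θ => Real.sin (2 * θ) ^ (17 * α / 30 - 1))]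
    have : α ^ 2 * (4 / (17 * α / 30)) = 120 / 17 * α := by field_simp; norm_num
    calc _ ≤ α ^ 2 * ((∫ z in Icc a b, q z ^ 2) * (4 / (17 * α / 30))) := by gcongr
      _ = (α ^ 2 * (4 / (17 * α / 30))) * ∫ z in Icc a b, q z ^ 2 := by ring
      _ = _ := by rw [this]
  have e3 := integral_transport_le h hp0 hp1
  have e2 := integral_rect_radial h.le h.dkz h.ck h.ckz h.ka h.kb hρ
  have e : (fun x : ℝ × ℝ => (k x.1 x.2 ^ 2 + x.1 * k x.1 x.2 * kz x.1 x.2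
        - 3 / (1 + x.1) * (2 * Real.cos (2 * x.2) * k x.1 x.2 ^ 2
          + Real.sin (2 * x.2) * k x.1 x.2 * kt x.1 x.2)) * Real.sin (2 * x.2) ^ p
        + q x.1 * k x.1 x.2 * (α / 3 * (2 * Real.cos x.2 ^ 2 - 4 * Real.sin x.2 ^ 2)
          * Gam α x.2) * Real.sin (2 * x.2) ^ (-(α / 10)))
      = fun x => k x.1 x.2 ^ 2 * Real.sin (2 * x.2) ^ p
      + x.1 * k x.1 x.2 * kz x.1 x.2 * Real.sin (2 * x.2) ^ p
      - 3 / (1 + x.1) * (2 * Real.cos (2 * x.2) * k x.1 x.2 ^ 2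
        + Real.sin (2 * x.2) * k x.1 x.2 * kt x.1 x.2) * Real.sin (2 * x.2) ^ p
      + q x.1 * k x.1 x.2 * (α / 3 * (2 * Real.cos x.2 ^ 2 - 4 * Real.sin x.2 ^ 2)
          * Gam α x.2) * Real.sin (2 * x.2) ^ (-(α / 10)) := by
    ext x; ring
  rw [e]
  refine ⟨i123.add i4, ?_⟩
  rw [integral_add i123 i4, integral_sub i12 i3, integral_add i1 i2, e2]
  have e6 : 1 - p = α / 10 := by rw [hp]; ring
  rw [e6] at e3
  nlinarith [mul_nonneg hα.le hQ]

theorem combined_energy_inequality {a b : ℝ} {g k gz kz kt : ℝ → ℝ → ℝ}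
    (h : IsProfile a b g k gz kz kt) {α β c : ℝ} (hα : 0 < α) (hα' : α < 1 / 10 ^ 14)
    (hc : 1 / 2 ≤ c) {l κ q : ℝ → ℝ}
    (hl : ∀ z, HasDerivAt l (-κ z) z) (hκ : Continuous κ) (hla : l a = 0) (hlb : l b = 0)
    (hκg : ∀ z ∈ Icc a b, κ z = (∫ θ in Icc 0 (π / 2), g z θ * Kker θ) * (z / (1 + z) ^ 2))
    (hβ : β ^ 2 ≤ ∫ x, (Real.sin (2 * x.2) * k x.1 x.2) ^ 2 ∂rect a b)
    (hq : q = fun z => 2 / c * (-(l z / z) + β / (1 + z))) :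
    ∫ x, g x.1 x.2 ^ 2 * Real.sin (2 * x.2) ^ ((1 / 100 : ℝ) - 1) ∂rect a b
        + ∫ x, k x.1 x.2 ^ 2 * Real.sin (2 * x.2) ^ (1 - α / 10) ∂rect a b
        + ∫ x, g x.1 x.2 ^ 2 * 1 ∂rect a b
      ≤ 10 * (∫ x, (g x.1 x.2 + x.1 * gz x.1 x.2 + q x.1 * Gam α x.2
        - 3 / (1 + x.1) * (Real.sin (2 * x.2) * k x.1 x.2)) * g x.1 x.2
          * Real.sin (2 * x.2) ^ ((1 / 100 : ℝ) - 1) ∂rect a b)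
      + 10 ^ 8 * (∫ x, (g x.1 x.2 + x.1 * gz x.1 x.2 + q x.1 * Gam α x.2
        - 3 / (1 + x.1) * (Real.sin (2 * x.2) * k x.1 x.2)) * g x.1 x.2 * 1 ∂rect a b)
      + 10 ^ 12 * ∫ x, (k x.1 x.2 ^ 2 + x.1 * k x.1 x.2 * kz x.1 x.2
        - 3 / (1 + x.1) * (2 * Real.cos (2 * x.2) * k x.1 x.2 ^ 2
          + Real.sin (2 * x.2) * k x.1 x.2 * kt x.1 x.2)) * Real.sin (2 * x.2) ^ (1 - α / 10)
        + q x.1 * k x.1 x.2 * (α / 3 * (2 * Real.cos x.2 ^ 2 - 4 * Real.sin x.2 ^ 2)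
          * Gam α x.2) * Real.sin (2 * x.2) ^ (-(α / 10)) ∂rect a b := by
  have ck : Continuous fun x : ℝ × ℝ => k x.1 x.2 := h.ck
  have hlc : Continuous l := continuous_iff_continuousAt.2 fun θ => (hl θ).continuousAt
  have c0 : ContinuousOn (fun z => l z / z) (Icc a b) :=
    hlc.continuousOn.div continuousOn_id fun z hz => (h.pos.trans_le hz.1).ne'
  have cq : ContinuousOn q (Icc a b) := by
    rw [hq]
    exact continuousOn_const.mul (c0.neg.add (continuousOn_div_one_add h.pos β))
  have hα1 : α < 1 / 10 ^ 14 := hα'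
  norm_num at hα1
  have hp0 : 0 ≤ 1 - α / 10 := by linarith
  obtain ⟨hη, hηJ⟩ := sin_two_mul_rpow_integral (ε := 1 / 100) (by norm_num) (by norm_num)
  have hη0 : ∀ θ ∈ Ioo 0 (π / 2), 0 ≤ Real.sin (2 * θ) ^ ((1 / 100 : ℝ) - 1) := fun θ hθ =>
    Real.rpow_nonneg (sin_two_mul_pos hθ).le _
  have hs2 : ∀ θ ∈ Ioo 0 (π / 2), Real.sin (2 * θ) ^ 2 ≤ Real.sin (2 * θ) ^ (1 - α / 10) := by
    intro θ hθ
    rw [← Real.rpow_two]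
    exact Real.rpow_le_rpow_of_exponent_ge (sin_two_mul_pos hθ) (Real.sin_le_one _) (by linarith)
  have E1 := (energy_lower_bound h hα hp0 cq hη hη0 fun θ hθ => by
    rw [← Real.rpow_two, ← Real.rpow_add (sin_two_mul_pos hθ)]
    exact Real.rpow_le_rpow_of_exponent_ge (sin_two_mul_pos hθ) (Real.sin_le_one _)
      (by linarith)).2
  have E2 := (energy_lower_bound h hα hp0 cq (ρ := fun _ => 1) (integrable_const _)
    (fun _ _ => zero_le_one) fun θ hθ => by rw [mul_one]; exact hs2 θ hθ).2
  have E3 := (derivative_energy_lower_bound h hα hα' cq).2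
  have N1 := integral_nonlocal_weighted_ge h hα cq hη hη0 hηJ
  have N2 := integral_nonlocal_ge h hα hc hl hκ hla hlb hκg hβ
  have Q1 := integral_sq_coefficient_le (β := β) hc h.pos h.le hlc
  have Q2 := integral_sq_potential_le h hl hκ hla hlb hκg
  have hSH : ∫ x, (Real.sin (2 * x.2) * k x.1 x.2) ^ 2 ∂rect a b
      ≤ ∫ x, k x.1 x.2 ^ 2 * Real.sin (2 * x.2) ^ (1 - α / 10) ∂rect a b := by
    refine integral_mono_ae (integrable_rect_of_continuousOn
      (Continuous.continuousOn (by fun_prop))) (integrable_rect (φ := fun x => k x.1 x.2 ^ 2)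
      (by fun_prop) (integrableOn_rpow_of_nonneg hp0)) (ae_rect fun z _ θ hθ => ?_)
    have := mul_le_mul_of_nonneg_left (hs2 θ hθ) (sq_nonneg (k z θ))
    dsimp only
    linarith
  have eq1 : ∫ z in Icc a b, q z ^ 2
      = ∫ z in Icc a b, (2 / c * (-(l z / z) + β / (1 + z))) ^ 2 := by rw [hq]
  have eq2 : ∫ x, q x.1 * Gam α x.2 * g x.1 x.2 * 1 ∂rect a b
      = ∫ x, 2 / c * (-(l x.1 / x.1) + β / (1 + x.1)) * Gam α x.2 * g x.1 x.2 ∂rect a b := by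
    rw [hq]; simp only [mul_one]
  have eq3 : ∫ x, g x.1 x.2 ^ 2 * 1 ∂rect a b = ∫ x, g x.1 x.2 ^ 2 ∂rect a b := by
    simp only [mul_one]
  rw [← eq1] at Q1
  rw [eq2] at E2
  rw [eq3] at E2 ⊢
  have hN : 0 ≤ ∫ x, g x.1 x.2 ^ 2 * Real.sin (2 * x.2) ^ ((1 / 100 : ℝ) - 1) ∂rect a b :=
    integral_nonneg_of_ae (ae_rect fun z _ θ hθ => mul_nonneg (sq_nonneg _) (hη0 θ hθ))
  have hG : 0 ≤ ∫ x, g x.1 x.2 ^ 2 ∂rect a b := integral_nonneg fun x => sq_nonneg _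
  have hQ : 0 ≤ ∫ z in Icc a b, q z ^ 2 := integral_nonneg fun z => sq_nonneg _
  have hS : 0 ≤ ∫ x, (Real.sin (2 * x.2) * k x.1 x.2) ^ 2 ∂rect a b :=
    integral_nonneg fun x => sq_nonneg _
  have hαQ : α * (∫ z in Icc a b, q z ^ 2) ≤ 1 / 10 ^ 14 * ∫ z in Icc a b, q z ^ 2 :=
    mul_le_mul_of_nonneg_right hα'.le hQ
  have h400 : (4 : ℝ) / (1 / 100) = 400 := by norm_num
  rw [h400] at N1
  norm_num only at hαQ
  nlinarith

theorem contDiff_uncurry_mul_of_vanish {f : ℝ → ℝ → ℝ} {u : ℝ → ℝ} {a : ℝ} (ha : 0 < a)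
    (hf : ContDiff ℝ (⊤ : ℕ∞) (Function.uncurry f)) (h0 : ∀ z θ, z < a → f z θ = 0)
    (hu : ∀ z, 0 < z → ContDiffAt ℝ (⊤ : ℕ∞) u z) :
    ContDiff ℝ (⊤ : ℕ∞) (Function.uncurry fun z θ => f z θ * u z) := by
  rw [contDiff_iff_contDiffAt]
  intro p
  rcases lt_or_ge 0 p.1 with hp | hp
  · exact hf.contDiffAt.mul ((hu p.1 hp).comp p contDiffAt_fst)
  · refine contDiffAt_const (c := (0 : ℝ)) |>.congr_of_eventuallyEq ?_
    have : ∀ᶠ x : ℝ × ℝ in nhds p, x.1 < a :=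
      (continuous_fst.tendsto p).eventually (gt_mem_nhds (hp.trans_lt ha))
    filter_upwards [this] with x hx
    simp [Function.uncurry, h0 x.1 x.2 hx]

theorem hasDerivAt_fst_fderiv {G : ℝ → ℝ → ℝ} (hG : ContDiff ℝ (⊤ : ℕ∞) (Function.uncurry G))
    (z θ : ℝ) :
    HasDerivAt (fun s => G s θ) (fderiv ℝ (Function.uncurry G) (z, θ) (1, 0)) z := by
  have h1 : HasFDerivAt (Function.uncurry G) (fderiv ℝ (Function.uncurry G) (z, θ)) (z, θ) :=
    (hG.differentiable (by simp) _).hasFDerivAt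
  exact h1.comp_hasDerivAt z ((hasDerivAt_id z).prodMk (hasDerivAt_const z θ))

theorem hasDerivAt_snd_fderiv {G : ℝ → ℝ → ℝ} (hG : ContDiff ℝ (⊤ : ℕ∞) (Function.uncurry G))
    (z θ : ℝ) :
    HasDerivAt (fun t => G z t) (fderiv ℝ (Function.uncurry G) (z, θ) (0, 1)) θ := by
  have h1 : HasFDerivAt (Function.uncurry G) (fderiv ℝ (Function.uncurry G) (z, θ)) (z, θ) :=
    (hG.differentiable (by simp) _).hasFDerivAt
  exact h1.comp_hasDerivAt θ ((hasDerivAt_const θ z).prodMk (hasDerivAt_id θ))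

theorem contDiff_deriv_fst {G : ℝ → ℝ → ℝ} (hG : ContDiff ℝ (⊤ : ℕ∞) (Function.uncurry G)) :
    ContDiff ℝ (⊤ : ℕ∞) (Function.uncurry fun z θ => deriv (fun s => G s θ) z) := by
  have e : (Function.uncurry fun z θ => deriv (fun s => G s θ) z)
      = fun p => fderiv ℝ (Function.uncurry G) p (1, 0) := by
    ext ⟨z, θ⟩
    exact (hasDerivAt_fst_fderiv hG z θ).deriv
  rw [e]
  exact (hG.fderiv_right (by simp)).clm_apply contDiff_const

theorem contDiff_deriv_snd {G : ℝ → ℝ → ℝ} (hG : ContDiff ℝ (⊤ : ℕ∞) (Function.uncurry G)) :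
    ContDiff ℝ (⊤ : ℕ∞) (Function.uncurry fun z θ => deriv (fun t => G z t) θ) := by
  have e : (Function.uncurry fun z θ => deriv (fun t => G z t) θ)
      = fun p => fderiv ℝ (Function.uncurry G) p (0, 1) := by
    ext ⟨z, θ⟩
    exact (hasDerivAt_snd_fderiv hG z θ).deriv
  rw [e]
  exact (hG.fderiv_right (by simp)).clm_apply contDiff_const

theorem hasDerivAt_fst {G : ℝ → ℝ → ℝ} (hG : ContDiff ℝ (⊤ : ℕ∞) (Function.uncurry G))
    (z θ : ℝ) : HasDerivAt (fun s => G s θ) (deriv (fun s => G s θ) z) z :=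
  (hasDerivAt_fst_fderiv hG z θ).differentiableAt.hasDerivAt

theorem hasDerivAt_snd {G : ℝ → ℝ → ℝ} (hG : ContDiff ℝ (⊤ : ℕ∞) (Function.uncurry G))
    (z θ : ℝ) : HasDerivAt (fun t => G z t) (deriv (fun t => G z t) θ) θ :=
  (hasDerivAt_snd_fderiv hG z θ).differentiableAt.hasDerivAt

theorem deriv_fst_deriv_snd {G : ℝ → ℝ → ℝ} (hG : ContDiff ℝ (⊤ : ℕ∞) (Function.uncurry G))
    (z θ : ℝ) :
    deriv (fun s => deriv (fun t => G s t) θ) z = deriv (fun t => deriv (fun s => G s t) z) θ := by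
  have h1 : HasFDerivAt (fderiv ℝ (Function.uncurry G))
      (fderiv ℝ (fderiv ℝ (Function.uncurry G)) (z, θ)) (z, θ) :=
    ((hG.fderiv_right (m := 1) (by norm_cast)).differentiable (by simp) _).hasFDerivAt
  have hs : IsSymmSndFDerivAt ℝ (Function.uncurry G) (z, θ) :=
    hG.contDiffAt.isSymmSndFDerivAt (by simpa using WithTop.coe_le_coe.2 (le_top (a := (2 : ℕ∞))))
  have e1 : ∀ s t, deriv (fun s => G s t) s = fderiv ℝ (Function.uncurry G) (s, t) (1, 0) :=
    fun s t => (hasDerivAt_fst_fderiv hG s t).deriv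
  have e2 : ∀ s t, deriv (fun t => G s t) t = fderiv ℝ (Function.uncurry G) (s, t) (0, 1) :=
    fun s t => (hasDerivAt_snd_fderiv hG s t).deriv
  simp only [e1, e2]
  have h2 := ((ContinuousLinearMap.apply ℝ ℝ ((0 : ℝ), (1 : ℝ))).hasFDerivAt.comp _ h1
    ).comp_hasDerivAt z ((hasDerivAt_id z).prodMk (hasDerivAt_const z θ))
  have h3 := ((ContinuousLinearMap.apply ℝ ℝ ((1 : ℝ), (0 : ℝ))).hasFDerivAt.comp _ h1
    ).comp_hasDerivAt θ ((hasDerivAt_const θ z).prodMk (hasDerivAt_id θ))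
  exact (h2.deriv.trans (hs (1, 0) (0, 1))).trans h3.deriv.symm

theorem isProfile_of_contDiff {a b : ℝ} (ha : 0 < a) (hab : a ≤ b) {g : ℝ → ℝ → ℝ}
    (hg : ContDiff ℝ (⊤ : ℕ∞) (Function.uncurry g)) (h0 : ∀ z θ, z ∉ Ioo a b → g z θ = 0) :
    IsProfile a b g (fun z θ => deriv (fun t => g z t) θ) (fun z θ => deriv (fun s => g s θ) z)
      (fun z θ => deriv (fun s => deriv (fun t => g s t) θ) z)
      (fun z θ => deriv (fun t => deriv (fun t => g z t) t) θ) where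
  pos := ha
  le := hab
  cg := hg.continuous
  ck := (contDiff_deriv_snd hg).continuous
  cgz := (contDiff_deriv_fst hg).continuous
  ckz := (contDiff_deriv_fst (contDiff_deriv_snd hg)).continuous
  ckt := (contDiff_deriv_snd (contDiff_deriv_snd hg)).continuous
  dg := hasDerivAt_snd hg
  dgz := hasDerivAt_fst hg
  dkz := hasDerivAt_fst (contDiff_deriv_snd hg)
  dkt := hasDerivAt_snd (contDiff_deriv_snd hg)
  ga θ := h0 a θ (by simp)
  gb θ := h0 b θ (by simp)
  ka θ := by simp [fun t => h0 a t (by simp)]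
  kb θ := by simp [fun t => h0 b t (by simp)]

theorem L12_eq_intervalIntegral {F : ℝ → ℝ → ℝ} {a b z : ℝ}
    (h0 : ∀ z θ, z ∉ Ioo a b → F z θ = 0) (hz : z ≤ b) :
    L12 F z = ∫ r in z..b, ∫ θ in Icc 0 (π / 2), F r θ * Kker θ / r := by
  rw [L12, intervalIntegral.integral_of_le hz]
  refine setIntegral_eq_of_subset_of_forall_sdiff_eq_zero measurableSet_Ioi
    (fun r hr => hr.1) fun r hr => ?_
  have : r ∉ Ioo a b := fun h => hr.2 ⟨hr.1, h.2.le⟩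
  simp [h0 r _ this]

theorem L12_zero_eq {F : ℝ → ℝ → ℝ} {a b : ℝ} (ha : 0 ≤ a)
    (h0 : ∀ z θ, z ∉ Ioo a b → F z θ = 0) : L12 F 0 = L12 F a := by
  refine setIntegral_eq_of_subset_of_forall_sdiff_eq_zero measurableSet_Ioi
    (Ioi_subset_Ioi ha) fun r hr => ?_
  have : r ∉ Ioo a b := fun h => hr.2 h.1
  simp [h0 r _ this]

theorem contDiffAt_wgt {z : ℝ} (hz : 0 < z) : ContDiffAt ℝ (⊤ : ℕ∞) wgt z :=
  ContDiffAt.div (by fun_prop) (by fun_prop) (pow_pos hz 2).ne'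

theorem hasDerivAt_wgt {z : ℝ} (hz : 0 < z) : HasDerivAt wgt (-2 * (1 + z) / z ^ 3) z := by
  refine ((((hasDerivAt_id z).const_add 1).pow 2).div ((hasDerivAt_id z).pow 2)
    (pow_pos hz 2).ne').congr_deriv ?_
  simp only [id, Pi.pow_apply]
  field_simp
  ring

theorem Dth_mul_wgt (f : ℝ → ℝ → ℝ) (z θ : ℝ) :
    Dth f z θ * wgt z = Real.sin (2 * θ) * deriv (fun t => f z t * wgt z) θ := by
  rw [Dth, deriv_mul_const_field, mul_assoc]

theorem Lop_mul_wgt {f : ℝ → ℝ → ℝ} (hf : ContDiff ℝ (⊤ : ℕ∞) (Function.uncurry f)) {z : ℝ}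
    (hz : 0 < z) (θ : ℝ) :
    Lop f z θ * wgt z = f z θ * wgt z + z * deriv (fun s => f s θ * wgt s) z := by
  have h := (hasDerivAt_fst hf z θ).mul (hasDerivAt_wgt hz)
  have e : deriv (fun s => f s θ * wgt s) z = _ := h.deriv
  rw [e, Lop, wgt]
  field_simp
  ring

theorem LGamT_mul_wgt {f : ℝ → ℝ → ℝ} (hf : ContDiff ℝ (⊤ : ℕ∞) (Function.uncurry f)) {α z : ℝ}
    (hz : 0 < z) (θ : ℝ) :
    LGamT α f z θ * wgt z = f z θ * wgt z + z * deriv (fun s => f s θ * wgt s) z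
      + 2 / cGam α * (-(L12 f z / z) + L12 (fun z θ => 3 / (1 + z) * Dth f z θ) 0 / (1 + z))
        * Gam α θ
      - 3 / (1 + z) * (Real.sin (2 * θ) * deriv (fun t => f z t * wgt z) θ) := by
  rw [← Lop_mul_wgt hf hz, ← Dth_mul_wgt, LGamT, LGam, Pproj]
  rcases eq_or_ne (cGam α) 0 with hc | hc
  · simp [hc]; ring
  · generalize Lop f z θ = A
    generalize L12 f z = B
    generalize Dth f z θ = D
    generalize L12 (fun z θ => 3 / (1 + z) * Dth f z θ) 0 = E
    rw [wgt]
    field_simp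
    ring

theorem exists_potential {a b : ℝ} (ha : 0 < a) (hab : a ≤ b) {f : ℝ → ℝ → ℝ}
    (hf : ContDiff ℝ (⊤ : ℕ∞) (Function.uncurry f)) (h0 : ∀ z θ, z ∉ Ioo a b → f z θ = 0)
    (hf0 : L12 f 0 = 0) :
    ∃ l κ : ℝ → ℝ, (∀ z, HasDerivAt l (-κ z) z) ∧ Continuous κ ∧ l a = 0 ∧ l b = 0 ∧
      (∀ z ∈ Icc a b,
        κ z = (∫ θ in Icc 0 (π / 2), f z θ * wgt z * Kker θ) * (z / (1 + z) ^ 2)) ∧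
      ∀ z ∈ Icc a b, L12 f z = l z := by
  have hF : ContDiff ℝ (⊤ : ℕ∞) (Function.uncurry fun z θ => f z θ * z⁻¹) :=
    contDiff_uncurry_mul_of_vanish ha hf (fun z θ hz => h0 z θ fun h => hz.not_ge h.1.le)
      fun z hz => contDiffAt_inv ℝ hz.ne'
  have hFc := hF.continuous
  have cK := continuous_Kker
  have hκ : Continuous fun z => ∫ θ in Icc 0 (π / 2), f z θ * z⁻¹ * Kker θ := by
    refine continuous_parametric_integral_of_continuous (f := fun z θ => f z θ * z⁻¹ * Kker θ)
      ?_ isCompact_Icc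
    exact hFc.mul (cK.comp continuous_snd)
  have hL : ∀ z ≤ b, L12 f z = ∫ r in z..b, ∫ θ in Icc 0 (π / 2), f r θ * r⁻¹ * Kker θ := by
    intro z hz
    rw [L12_eq_intervalIntegral h0 hz]
    simp only [div_eq_mul_inv, mul_right_comm]
  refine ⟨fun z => ∫ r in z..b, ∫ θ in Icc 0 (π / 2), f r θ * r⁻¹ * Kker θ, _,
    fun z => ?_, hκ, ?_, intervalIntegral.integral_same, fun z hz => ?_, fun z hz => hL z hz.2⟩
  · exact intervalIntegral.integral_hasDerivAt_left (hκ.intervalIntegrable _ _)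
      (hκ.stronglyMeasurableAtFilter _ _) hκ.continuousAt
  · dsimp only
    rw [← hL a hab, ← L12_zero_eq ha.le h0, hf0]
  · have hz0 : 0 < z := ha.trans_le hz.1
    rw [← integral_mul_const]
    congr 1; ext θ
    rw [wgt]
    field_simp

theorem sq_L12_transport_le {a b : ℝ} (ha : 0 < a) (hab : a ≤ b) {f : ℝ → ℝ → ℝ}
    (h0 : ∀ z θ, z ∉ Ioo a b → f z θ = 0)
    (hk : Continuous fun x : ℝ × ℝ => deriv (fun t => f x.1 t * wgt x.1) x.2) :
    L12 (fun z θ => 3 / (1 + z) * Dth f z θ) 0 ^ 2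
      ≤ ∫ x, (Real.sin (2 * x.2) * deriv (fun t => f x.1 t * wgt x.1) x.2) ^ 2 ∂rect a b := by
  have cK := continuous_Kker
  have cS : Continuous fun x : ℝ × ℝ =>
      Real.sin (2 * x.2) * deriv (fun t => f x.1 t * wgt x.1) x.2 := by fun_prop
  have cR : ContinuousOn (fun z : ℝ => 3 * z / (1 + z) ^ 3) (Icc a b) :=
    ContinuousOn.div (by fun_prop) (by fun_prop) fun z hz =>
      pow_ne_zero _ (by linarith [hz.1])
  have cRK : ContinuousOn (fun x : ℝ × ℝ => 3 * x.1 / (1 + x.1) ^ 3 * Kker x.2)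
      (Icc a b ×ˢ Icc 0 (π / 2)) :=
    (continuousOn_rect_fst cR).mul (Continuous.continuousOn (by fun_prop))
  have iSRK : Integrable (fun x : ℝ × ℝ => Real.sin (2 * x.2)
      * deriv (fun t => f x.1 t * wgt x.1) x.2 * (3 * x.1 / (1 + x.1) ^ 3 * Kker x.2))
      (rect a b) := integrable_rect_of_continuousOn (cS.continuousOn.mul cRK)
  have e : L12 (fun z θ => 3 / (1 + z) * Dth f z θ) 0
      = ∫ x, Real.sin (2 * x.2) * deriv (fun t => f x.1 t * wgt x.1) x.2
        * (3 * x.1 / (1 + x.1) ^ 3 * Kker x.2) ∂rect a b := by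
    rw [← ip_eq_integral_rect (A := fun z θ => 3 / (1 + z) * Dth f z θ)
      (B := fun z θ => Kker θ / z) ha iSRK, L12, ip]
    · simp only [mul_div_assoc]
    · intro z θ hz
      have : (fun t => f z t) = fun _ => 0 := by
        ext t; exact h0 z t fun h => hz (Ioo_subset_Icc_self h)
      simp [Dth, this]
    · intro z hz θ _
      have hz0 : 0 < z := ha.trans_le hz.1
      dsimp only
      rw [← Dth_mul_wgt, wgt]
      field_simp
  rw [e]
  refine (sq_integral_mul_le (integrable_rect_of_continuousOn (cS.pow 2).continuousOn)
    (integrable_rect_of_continuousOn (cRK.pow 2)) iSRK).trans ?_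
  refine mul_le_of_le_one_right (integral_nonneg fun x => sq_nonneg _) ?_
  simp only [mul_pow]
  rw [integral_rect_mul a b (fun z => (3 * z / (1 + z) ^ 3) ^ 2) (fun θ => Kker θ ^ 2)]
  have h1 : ∫ z in Icc a b, (3 * z / (1 + z) ^ 3) ^ 2
      ≤ ∫ z in Icc a b, 9 / 16 * (1 / (1 + z)) ^ 2 := by
    refine setIntegral_mono_on (cR.pow 2).integrableOn_Icc
      (((continuousOn_div_one_add ha 1).pow 2).integrableOn_Icc.const_mul _) measurableSet_Icc
      fun z hz => ?_
    have hz0 : 0 < z := ha.trans_le hz.1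
    have h2 : z / (1 + z) ^ 2 ≤ 1 / 4 := by
      rw [div_le_iff₀ (by positivity)]; nlinarith [sq_nonneg (1 - z)]
    have h3 : (z / (1 + z) ^ 2) ^ 2 ≤ (1 / 4) ^ 2 := by gcongr
    calc (3 * z / (1 + z) ^ 3) ^ 2 = 9 * (z / (1 + z) ^ 2) ^ 2 * (1 / (1 + z)) ^ 2 := by
          field_simp; ring
      _ ≤ 9 * (1 / 4) ^ 2 * (1 / (1 + z)) ^ 2 := by gcongr
      _ = _ := by ring
  rw [integral_const_mul] at h1
  have h2 := integral_inv_one_add_sq_le ha hab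
  have h3 : 0 ≤ ∫ z in Icc a b, (3 * z / (1 + z) ^ 3) ^ 2 := integral_nonneg fun z => sq_nonneg _
  nlinarith [integral_Kker_sq_le]

/-- Combined first-order coercivity of `𝓛_Γ^T`: for `0 < α < 10⁻¹⁴`, `η = 99/100`,
`γ = 1 + α/10`, and every admissible `f` with `L₁₂(f)(0) = 0`,
`10(𝓛_Γ^T(f)·w, f·w/sin(2θ)^η) + 10⁸(𝓛_Γ^T(f)·w, f·w)
  + 10¹²(D_θ(𝓛_Γ^T(f)), (D_θ f)·w²/sin(2θ)^γ)
  ≥ ‖f·w/sin(2θ)^{η/2}‖² + ‖(D_θ f)·w/sin(2θ)^{γ/2}‖² + ‖f·w‖²`. -/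
theorem LGamT_combined_coercivity (α : ℝ) (hα : 0 < α) (hα' : α < 1 / 10 ^ 14)
    (η γ : ℝ) (hη : η = 99 / 100) (hγ : γ = 1 + α / 10)
    (f : ℝ → ℝ → ℝ) (hf : Admissible f) (hf0 : L12 f 0 = 0) :
    10 * ip (fun z θ => LGamT α f z θ * wgt z)
          (fun z θ => f z θ * wgt z / Real.sin (2 * θ) ^ η) +
      10 ^ 8 * ip (fun z θ => LGamT α f z θ * wgt z) (fun z θ => f z θ * wgt z) +
      10 ^ 12 * ip (Dth (LGamT α f))
          (fun z θ => Dth f z θ * wgt z ^ 2 / Real.sin (2 * θ) ^ γ) ≥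
    ip (fun z θ => f z θ * wgt z / Real.sin (2 * θ) ^ (η / 2))
        (fun z θ => f z θ * wgt z / Real.sin (2 * θ) ^ (η / 2)) +
      ip (fun z θ => Dth f z θ * wgt z / Real.sin (2 * θ) ^ (γ / 2))
        (fun z θ => Dth f z θ * wgt z / Real.sin (2 * θ) ^ (γ / 2)) +
      ip (fun z θ => f z θ * wgt z) (fun z θ => f z θ * wgt z) := by
  obtain ⟨hfs, a₀, b₀, ha₀, hsupp⟩ := hf
  obtain ⟨a, b, ha, hab, h0⟩ : ∃ a b : ℝ, 0 < a ∧ a ≤ b ∧ ∀ z θ, z ∉ Ioo a b → f z θ = 0 := by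
    refine ⟨a₀ / 2, max a₀ b₀ + 1, by linarith, ?_, fun z θ hz => hsupp z θ fun h => hz ⟨?_, ?_⟩⟩
    · linarith [le_max_left a₀ b₀]
    · linarith [h.1]
    · linarith [h.2, le_max_right a₀ b₀]
  have h0' : ∀ z, z ∉ Icc a b → ∀ θ, f z θ = 0 := fun z hz θ =>
    h0 z θ fun h => hz (Ioo_subset_Icc_self h)
  have hD0 : ∀ z, z ∉ Icc a b → ∀ θ, Dth f z θ = 0 := by
    intro z hz θ
    simp [Dth, fun t => h0' z hz t]
  have hgs : ContDiff ℝ (⊤ : ℕ∞) (Function.uncurry fun z θ => f z θ * wgt z) :=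
    contDiff_uncurry_mul_of_vanish ha hfs (fun z θ hz => h0 z θ fun h => hz.not_ge h.1.le)
      fun z hz => contDiffAt_wgt hz
  have h := isProfile_of_contDiff ha hab hgs fun z θ hz => by simp [h0 z θ hz]
  obtain ⟨l, κ, hl, hκ, hla, hlb, hκg, hL⟩ := exists_potential ha hab hfs h0 hf0
  have hβ := sq_L12_transport_le ha hab h0 h.ck
  have hmix := deriv_fst_deriv_snd hgs
  have hgz := contDiff_deriv_fst hgs
  have hLT : ∀ z ∈ Icc a b, ∀ θ, _ := fun z hz θ =>
    LGamT_mul_wgt (α := α) hfs (ha.trans_le hz.1) θ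
  set β := L12 (fun z θ => 3 / (1 + z) * Dth f z θ) 0 with hβ_def
  set g : ℝ → ℝ → ℝ := fun z θ => f z θ * wgt z with hg
  set k : ℝ → ℝ → ℝ := fun z θ => deriv (fun t => g z t) θ with hk
  set gz : ℝ → ℝ → ℝ := fun z θ => deriv (fun s => g s θ) z with hgz_def
  set kz : ℝ → ℝ → ℝ := fun z θ => deriv (fun s => k s θ) z with hkz
  set kt : ℝ → ℝ → ℝ := fun z θ => deriv (fun t => k z t) θ with hkt
  set q : ℝ → ℝ := fun z => 2 / cGam α * (-(l z / z) + β / (1 + z)) with hq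
  have hLT1 : ∀ z ∈ Icc a b, ∀ θ, LGamT α f z θ * wgt z = g z θ + z * gz z θ + q z * Gam α θ
      - 3 / (1 + z) * (Real.sin (2 * θ) * k z θ) := by
    intro z hz θ
    rw [hLT z hz θ, hL z hz]
  have hDf : ∀ z θ, Dth f z θ * wgt z = Real.sin (2 * θ) * k z θ := Dth_mul_wgt f
  have hDL : ∀ z ∈ Icc a b, ∀ θ ∈ Ioo 0 (π / 2), Dth (LGamT α f) z θ * wgt z
      = Real.sin (2 * θ) * (k z θ + z * kz z θ
          - 3 / (1 + z) * (2 * Real.cos (2 * θ) * k z θ + Real.sin (2 * θ) * kt z θ))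
        + q z * (α / 3 * (2 * Real.cos θ ^ 2 - 4 * Real.sin θ ^ 2) * Gam α θ) := by
    intro z hz θ hθ
    obtain ⟨d, hd, hd'⟩ := Dth_Gam (α := α) hθ
    have hs : HasDerivAt (fun t => Real.sin (2 * t)) (2 * Real.cos (2 * θ)) θ := by
      simpa [mul_comm] using ((hasDerivAt_id θ).const_mul 2).sin
    have hgzt : HasDerivAt (fun t => gz z t) (kz z θ) θ := by
      rw [show kz z θ = deriv (fun t => gz z t) θ from hmix z θ]
      exact hasDerivAt_snd hgz z θ
    have hder := (((h.dg z θ).add (hgzt.const_mul z)).add (hd.const_mul (q z))).sub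
      ((hs.mul (h.dkt z θ)).const_mul (3 / (1 + z)))
    rw [Dth_mul_wgt]
    have e : (fun t => LGamT α f z t * wgt z) = _ := funext fun t => hLT1 z hz t
    rw [e]
    have e2 := hder.deriv
    refine (congrArg (Real.sin (2 * θ) * ·) e2).trans ?_
    rw [← hd']
    ring
  have hlc : Continuous l := continuous_iff_continuousAt.2 fun θ => (hl θ).continuousAt
  have cq : ContinuousOn q (Icc a b) :=
    continuousOn_const.mul ((hlc.continuousOn.div continuousOn_id
      fun z hz => (ha.trans_le hz.1).ne').neg.add (continuousOn_div_one_add ha β))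
  have hα1 : α < 1 / 10 ^ 14 := hα'
  norm_num at hα1
  have hp0 : 0 ≤ 1 - α / 10 := by linarith
  have cg : Continuous fun x : ℝ × ℝ => g x.1 x.2 := h.cg
  have ck : Continuous fun x : ℝ × ℝ => k x.1 x.2 := h.ck
  obtain ⟨hη1, -⟩ := sin_two_mul_rpow_integral (ε := 1 / 100) (by norm_num) (by norm_num)
  have hη0 : ∀ θ ∈ Ioo 0 (π / 2), 0 ≤ Real.sin (2 * θ) ^ ((1 / 100 : ℝ) - 1) := fun θ hθ =>
    Real.rpow_nonneg (sin_two_mul_pos hθ).le _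
  have hs2 : ∀ {r : ℝ}, r ≤ 2 → ∀ θ ∈ Ioo 0 (π / 2),
      Real.sin (2 * θ) ^ 2 ≤ Real.sin (2 * θ) ^ r := by
    intro r hr θ hθ
    rw [← Real.rpow_two]
    exact Real.rpow_le_rpow_of_exponent_ge (sin_two_mul_pos hθ) (Real.sin_le_one _) hr
  have I1 := (energy_lower_bound h hα hp0 cq hη1 hη0 fun θ hθ => by
    rw [← Real.rpow_two, ← Real.rpow_add (sin_two_mul_pos hθ)]
    exact Real.rpow_le_rpow_of_exponent_ge (sin_two_mul_pos hθ) (Real.sin_le_one _)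
      (by linarith)).1
  have I2 := (energy_lower_bound h hα hp0 cq (ρ := fun _ => 1) (integrable_const _)
    (fun _ _ => zero_le_one) fun θ hθ => by rw [mul_one]; exact hs2 (by linarith) θ hθ).1
  have I3 := (derivative_energy_lower_bound h hα hα' cq).1
  have J1 : Integrable (fun x : ℝ × ℝ => g x.1 x.2 ^ 2 * Real.sin (2 * x.2) ^ ((1 / 100 : ℝ) - 1))
      (rect a b) := integrable_rect (φ := fun x => g x.1 x.2 ^ 2) (by fun_prop) hη1
  have J2 : Integrable (fun x : ℝ × ℝ => k x.1 x.2 ^ 2 * Real.sin (2 * x.2) ^ (1 - α / 10))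
      (rect a b) := integrable_rect (φ := fun x => k x.1 x.2 ^ 2) (by fun_prop)
        (integrableOn_rpow_of_nonneg hp0)
  have J3 : Integrable (fun x : ℝ × ℝ => g x.1 x.2 ^ 2 * 1) (rect a b) :=
    integrable_rect_of_continuousOn (by fun_prop)
  have hγ2 : ∀ θ ∈ Ioo 0 (π / 2), Real.sin (2 * θ) ^ 2 / Real.sin (2 * θ) ^ γ
      = Real.sin (2 * θ) ^ (1 - α / 10) := by
    intro θ hθ
    rw [← Real.rpow_two, ← Real.rpow_sub (sin_two_mul_pos hθ), hγ]
    congr 1; ring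
  have hγ1 : ∀ θ ∈ Ioo 0 (π / 2), Real.sin (2 * θ) / Real.sin (2 * θ) ^ γ
      = Real.sin (2 * θ) ^ (-(α / 10)) := by
    intro θ hθ
    nth_rewrite 1 [← Real.rpow_one (Real.sin (2 * θ))]
    rw [← Real.rpow_sub (sin_two_mul_pos hθ), hγ]
    congr 1; ring
  have hη2 : ∀ θ ∈ Ioo 0 (π / 2), 1 / Real.sin (2 * θ) ^ η
      = Real.sin (2 * θ) ^ ((1 / 100 : ℝ) - 1) := by
    intro θ hθ
    rw [one_div, ← Real.rpow_neg (sin_two_mul_pos hθ).le, hη]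
    congr 1; norm_num
  have hhalf : ∀ r : ℝ, ∀ θ ∈ Ioo 0 (π / 2), (Real.sin (2 * θ) ^ (r / 2)) ^ 2
      = Real.sin (2 * θ) ^ r := by
    intro r θ hθ
    rw [← Real.rpow_mul_natCast (sin_two_mul_pos hθ).le]
    congr 1; push_cast; ring
  rw [ge_iff_le,
    ip_eq_integral_rect ha J1 (fun z θ hz => by simp [h0' z hz]) fun z hz θ hθ => by
      rw [← pow_two, div_pow, hhalf η θ hθ, ← hη2 θ hθ, mul_one_div],
    ip_eq_integral_rect ha J2 (fun z θ hz => by simp [hD0 z hz]) fun z hz θ hθ => by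
      rw [← pow_two, div_pow, hhalf γ θ hθ, hDf, ← hγ2 θ hθ]; ring,
    ip_eq_integral_rect ha J3 (fun z θ hz => by simp [hg, h0' z hz]) fun z hz θ hθ => by
      rw [← pow_two, mul_one],
    ip_eq_integral_rect ha I1 (fun z θ hz => by simp [h0' z hz]) fun z hz θ hθ => by
      rw [hLT1 z hz θ, ← hη2 θ hθ]; ring,
    ip_eq_integral_rect ha I2 (fun z θ hz => by simp [hg, h0' z hz]) fun z hz θ hθ => by
      rw [hLT1 z hz θ, mul_one],
    ip_eq_integral_rect ha I3 (fun z θ hz => by simp [hD0 z hz]) fun z hz θ hθ => by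
      rw [show Dth (LGamT α f) z θ * (Dth f z θ * wgt z ^ 2 / Real.sin (2 * θ) ^ γ)
        = Dth (LGamT α f) z θ * wgt z * (Dth f z θ * wgt z) / Real.sin (2 * θ) ^ γ by ring,
        hDL z hz θ hθ, hDf, ← hγ2 θ hθ, ← hγ1 θ hθ]
      ring]
  exact combined_energy_inequality h hα hα' (half_le_cGam hα hα') hl hκ hla hlb hκg hβ hq
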